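/- arXiv:math/0312453 — 4 statements merged into one kernel-verified Lean document; each statement's English description precedes it below -/
import Mathlib

section
/- Let n ≥ 1 be an integer and let κ be a complex number with Re κ > 0. Then (1/n!) · ∫_{Ω_n} D_n(x²) · D_n(x) · ∏_{i=1}^n x_i^{κ−1} dx = 2^{n(n−1)/2} · (∏_{i=0}^{n−1} i! · Γ(κ+2i)) / Γ(3n(n−1)/2 + nκ + 1), where the integral is with respect to Lebesgue measure on ℝ^n. -/
open MeasureTheory Finset

/-- The points of `ℝⁿ` with nonnegative coordinates whose sum is at most `r`. -/
def cornerSimplex (n : ℕ) (r : ℝ) : Set (Fin n → ℝ) :=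
  {x | (∀ i, 0 ≤ x i) ∧ ∑ i, x i ≤ r}

theorem measurableSet_cornerSimplex (n : ℕ) (r : ℝ) : MeasurableSet (cornerSimplex n r) := by
  have h : IsClosed (cornerSimplex n r) := by
    have h1 : cornerSimplex n r = (⋂ i, {x | 0 ≤ x i}) ∩ {x | ∑ i, x i ≤ r} := by
      ext x; simp [cornerSimplex]
    rw [h1]
    exact (isClosed_iInter fun i => isClosed_le continuous_const (continuous_apply i)).inter
      (isClosed_le (by fun_prop) continuous_const)
  exact h.measurableSet

theorem cons_mem_cornerSimplex_iff {n : ℕ} {r t : ℝ} {y : Fin n → ℝ} :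
    (Fin.cons t y : Fin (n + 1) → ℝ) ∈ cornerSimplex (n + 1) r ↔
      t ∈ Set.Icc 0 r ∧ y ∈ cornerSimplex n (r - t) := by
  simp only [cornerSimplex, Set.mem_ofPred_eq, Fin.forall_fin_succ, Fin.sum_univ_succ,
    Fin.cons_zero, Fin.cons_succ, Set.mem_Icc]
  constructor
  · rintro ⟨⟨h0, h1⟩, h2⟩
    have := Finset.sum_nonneg fun i (_ : i ∈ Finset.univ) => h1 i
    exact ⟨⟨h0, by linarith⟩, h1, by linarith⟩
  · rintro ⟨⟨h0, -⟩, h1, h2⟩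
    exact ⟨⟨h0, h1⟩, by linarith⟩

theorem integrableOn_cornerSimplex_prod_cpow {n : ℕ} {a : Fin n → ℂ} (ha : ∀ i, 0 < (a i).re)
    {r : ℝ} (hr : 0 ≤ r) :
    IntegrableOn (fun x : Fin n → ℝ => ∏ i, (x i : ℂ) ^ (a i - 1)) (cornerSimplex n r) := by
  have hf (i : Fin n) :
      Integrable ((Set.Icc 0 r).indicator fun t : ℝ => (t : ℂ) ^ (a i - 1)) := by
    rw [integrable_indicator_iff measurableSet_Icc, integrableOn_Icc_iff_integrableOn_Ioc,
      ← intervalIntegrable_iff_integrableOn_Ioc_of_le hr]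
    exact intervalIntegral.intervalIntegrable_cpow' (by simpa using ha i)
  refine (Integrable.fintype_prod hf).integrableOn.congr_fun (fun x hx => ?_)
    (measurableSet_cornerSimplex n r)
  refine Finset.prod_congr rfl fun i _ => ?_
  have hi : x i ∈ Set.Icc 0 r :=
    ⟨hx.1 i, (Finset.single_le_sum (fun j _ => hx.1 j) (Finset.mem_univ i)).trans hx.2⟩
  exact Set.indicator_of_mem hi _

theorem integral_cornerSimplex_succ {n : ℕ} {a : Fin (n + 1) → ℂ} (ha : ∀ i, 0 < (a i).re)
    {r : ℝ} (hr : 0 ≤ r) :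
    ∫ x in cornerSimplex (n + 1) r, ∏ i, (x i : ℂ) ^ (a i - 1) =
      ∫ t in (0 : ℝ)..r, (t : ℂ) ^ (a 0 - 1) *
        ∫ y in cornerSimplex n (r - t), ∏ i, (y i : ℂ) ^ (a i.succ - 1) := by
  have hintegrable := (integrable_indicator_iff (measurableSet_cornerSimplex (n + 1) r)).2
    (integrableOn_cornerSimplex_prod_cpow ha hr)
  have hmp := (volume_preserving_piFinSuccAbove (fun _ : Fin (n + 1) => ℝ) 0).symm
  have hcons (p : ℝ × (Fin n → ℝ)) :
      (MeasurableEquiv.piFinSuccAbove (fun _ : Fin (n + 1) => ℝ) 0).symm p =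
        Fin.cons p.1 p.2 := by
    simp [MeasurableEquiv.piFinSuccAbove_symm_apply, Fin.insertNthEquiv]
  have hcomp := (hmp.integrable_comp_emb (MeasurableEquiv.measurableEmbedding _)).2 hintegrable
  rw [Measure.volume_eq_prod, Function.comp_def] at hcomp
  rw [← integral_indicator (measurableSet_cornerSimplex _ _), ← hmp.integral_comp',
    Measure.volume_eq_prod, integral_prod _ hcomp, intervalIntegral.integral_of_le hr,
    ← integral_Icc_eq_integral_Ioc, ← integral_indicator measurableSet_Icc]
  congr 1 with t
  simp only [hcons]
  by_cases ht : t ∈ Set.Icc 0 r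
  · rw [Set.indicator_of_mem ht, ← integral_const_mul,
      ← integral_indicator (measurableSet_cornerSimplex _ _)]
    congr 1 with y
    by_cases hy : y ∈ cornerSimplex n (r - t)
    · rw [Set.indicator_of_mem hy, Set.indicator_of_mem (cons_mem_cornerSimplex_iff.2 ⟨ht, hy⟩)]
      simp [Fin.prod_univ_succ]
    · rw [Set.indicator_of_notMem hy,
        Set.indicator_of_notMem fun h => hy (cons_mem_cornerSimplex_iff.1 h).2]
  · rw [Set.indicator_of_notMem ht]
    refine (integral_congr_ae (.of_forall fun y => ?_)).trans (integral_zero _ _)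
    exact Set.indicator_of_notMem (fun h => ht (cons_mem_cornerSimplex_iff.1 h).1) _

/-- **Dirichlet's integral formula**. -/
theorem integral_cornerSimplex_prod_cpow {n : ℕ} {a : Fin n → ℂ} (ha : ∀ i, 0 < (a i).re)
    {r : ℝ} (hr : 0 ≤ r) :
    ∫ x in cornerSimplex n r, ∏ i, (x i : ℂ) ^ (a i - 1) =
      (r : ℂ) ^ (∑ i, a i) * (∏ i, Complex.Gamma (a i)) / Complex.Gamma (∑ i, a i + 1) := by
  induction n generalizing r with
  | zero =>
    have : cornerSimplex 0 r = Set.univ := by ext x; simp [cornerSimplex, hr]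
    simp [this, measureReal_def, volume_pi]
  | succ n ih =>
    rw [integral_cornerSimplex_succ ha hr, Fin.sum_univ_succ, Fin.prod_univ_succ]
    set A := ∑ i : Fin n, a i.succ with hA_def
    have hA : 0 ≤ A.re := by
      rw [hA_def, Complex.re_sum]
      exact Finset.sum_nonneg fun i _ => (ha _).le
    rcases hr.eq_or_lt with rfl | hr
    · have h0 : a 0 + A ≠ 0 := fun h => by
        have := congrArg Complex.re h
        have := ha 0
        simp at *
        linarith
      simp [Complex.zero_cpow h0]
    set C := (∏ i : Fin n, Complex.Gamma (a i.succ)) / Complex.Gamma (A + 1) with hC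
    have hA1 : 0 < (A + 1).re := by simp; linarith
    have hΓ := Complex.Gamma_mul_Gamma_eq_betaIntegral (ha 0) hA1
    have hΓ1 := Complex.Gamma_ne_zero_of_re_pos hA1
    have hs : 0 < (a 0 + (A + 1)).re := by
      have := ha 0
      simp at *
      linarith
    have hΓ2 := Complex.Gamma_ne_zero_of_re_pos hs
    calc _ = ∫ t in (0 : ℝ)..r,
          C * ((t : ℂ) ^ (a 0 - 1) * ((r : ℂ) - t) ^ (A + 1 - 1)) := by
          refine intervalIntegral.integral_congr fun t ht => ?_
          rw [Set.uIcc_of_le hr.le] at ht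
          simp only [ih (fun i => ha i.succ) (sub_nonneg.2 ht.2), ← hA_def, hC]
          push_cast
          rw [add_sub_cancel_right]
          ring
      _ = C * ((r : ℂ) ^ (a 0 + A) * Complex.betaIntegral (a 0) (A + 1)) := by
          rw [intervalIntegral.integral_const_mul, Complex.betaIntegral_scaled _ _ hr]
          congr 4
          ring
      _ = _ := by
          rw [add_assoc, eq_div_iff hΓ2, hC]
          field_simp
          linear_combination (-(r : ℂ) ^ (a 0 + A) *
            (∏ i : Fin n, Complex.Gamma (a i.succ))) * hΓ

theorem det_vandermonde_const_mul {R : Type*} [CommRing R] {n : ℕ} (c : R) (v : Fin n → R) :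
    (Matrix.vandermonde fun i => c * v i).det =
      c ^ (n * (n - 1) / 2) * (Matrix.vandermonde v).det := by
  have h : (Matrix.vandermonde fun i => c * v i) =
      Matrix.of fun i j : Fin n => c ^ (j : ℕ) * Matrix.vandermonde v i j := by
    ext i j
    simp [Matrix.vandermonde_apply, mul_pow]
  rw [h, Matrix.det_mul_row, Finset.prod_pow_eq_pow_sum, Fin.sum_univ_eq_sum_range fun i => i,
    Finset.sum_range_id]

theorem det_vandermonde_natCast (R : Type*) [CommRing R] (n : ℕ) :
    (Matrix.vandermonde fun i : Fin n => (i : R)).det =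
      ∏ i ∈ Finset.range n, (Nat.factorial i : R) := by
  cases n with
  | zero => simp
  | succ n =>
    rw [Matrix.det_vandermonde_id_eq_superFactorial, ← Nat.prod_range_succ_factorial]
    push_cast
    rfl

theorem det_Gamma_add (n : ℕ) (v : Fin n → ℂ) (hv : ∀ i, 0 < (v i).re) :
    (Matrix.of fun i j : Fin n => Complex.Gamma (v i + j)).det =
      (∏ i, Complex.Gamma (v i)) * (Matrix.vandermonde v).det := by
  rw [Matrix.det_eval_matrixOfPolynomials_eq_det_vandermonde v (fun j => ascPochhammer ℂ j)
    (fun j => ascPochhammer_natDegree _ _) (fun j => monic_ascPochhammer _ _),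
    ← Matrix.det_mul_column]
  congr 1
  ext i j
  rw [Matrix.of_apply, Matrix.of_apply, Matrix.of_apply, ← Complex.Gamma_add_nat_div_Gamma_eq,
    mul_div_cancel₀ _ (Complex.Gamma_ne_zero_of_re_pos (hv i))]
  intro k hk
  have := hv i
  simp [hk] at this
  linarith

theorem det_Gamma_two_mul_add (n : ℕ) {κ : ℂ} (hκ : 0 < κ.re) :
    (Matrix.of fun i j : Fin n => Complex.Gamma (κ + 2 * i + j)).det =
      2 ^ (n * (n - 1) / 2) *
        ∏ i ∈ Finset.range n, (Nat.factorial i : ℂ) * Complex.Gamma (κ + 2 * i) := by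
  rw [det_Gamma_add n (fun i => κ + 2 * i) fun i => by simp; positivity]
  simp_rw [add_comm κ]
  rw [Matrix.det_vandermonde_add, det_vandermonde_const_mul, det_vandermonde_natCast,
    Finset.prod_mul_distrib, Fin.prod_univ_eq_prod_range fun i : ℕ => Complex.Gamma (2 * i + κ)]
  ring

theorem sum_perm_sum_perm_sign_mul_prod {R : Type*} [CommRing R] {ι : Type*} [Fintype ι]
    [DecidableEq ι] (M : Matrix ι ι R) :
    ∑ σ : Equiv.Perm ι, ∑ τ : Equiv.Perm ι,
      ((Equiv.Perm.sign σ : ℤ) : R) * ((Equiv.Perm.sign τ : ℤ) : R) * ∏ i, M (σ i) (τ i) =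
        (Fintype.card ι).factorial * M.det := by
  have h (σ : Equiv.Perm ι) : ∑ τ : Equiv.Perm ι,
      ((Equiv.Perm.sign σ : ℤ) : R) * ((Equiv.Perm.sign τ : ℤ) : R) * ∏ i, M (σ i) (τ i) =
        M.det := by
    simp_rw [mul_assoc, ← Finset.mul_sum]
    have h1 := Matrix.det_apply' (M.submatrix σ id).transpose
    rw [Matrix.det_transpose, Matrix.det_permute] at h1
    simp only [Matrix.transpose_apply, Matrix.submatrix_apply, id] at h1
    rw [← h1, ← mul_assoc, ← Int.cast_mul, ← Units.val_mul, Int.units_mul_self]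
    simp
  simp [h, Fintype.card_perm]

theorem prod_sub_sq_mul_prod_sub_eq_sum {R : Type*} [CommRing R] {n : ℕ} (x : Fin n → R) :
    (∏ i : Fin n, ∏ j ∈ Finset.Ioi i, ((x i) ^ 2 - (x j) ^ 2)) *
        (∏ i : Fin n, ∏ j ∈ Finset.Ioi i, (x i - x j)) =
      ∑ σ : Equiv.Perm (Fin n), ∑ τ : Equiv.Perm (Fin n),
        ((Equiv.Perm.sign σ : ℤ) : R) * ((Equiv.Perm.sign τ : ℤ) : R) *
          ∏ i, x i ^ (2 * (σ i : ℕ) + τ i) := by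
  have h : (∏ i : Fin n, ∏ j ∈ Finset.Ioi i, ((x i) ^ 2 - (x j) ^ 2)) *
      (∏ i : Fin n, ∏ j ∈ Finset.Ioi i, (x i - x j)) =
        (Matrix.vandermonde fun i => x i ^ 2).transpose.det *
          (Matrix.vandermonde x).transpose.det := by
    simp only [Matrix.det_transpose, Matrix.det_vandermonde, ← Finset.prod_mul_distrib]
    exact Finset.prod_congr rfl fun i _ => Finset.prod_congr rfl fun j _ => by ring
  rw [h, Matrix.det_apply', Matrix.det_apply', Finset.sum_mul_sum]
  refine Finset.sum_congr rfl fun σ _ => Finset.sum_congr rfl fun τ _ => ?_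
  simp only [Matrix.transpose_apply, Matrix.vandermonde_apply, pow_add, pow_mul,
    Finset.prod_mul_distrib]
  ring

theorem pow_mul_cpow_sub_one {κ : ℂ} (hκ : 0 < κ.re) (t : ℂ) (m : ℕ) :
    t ^ m * t ^ (κ - 1) = t ^ (κ + m - 1) := by
  rcases eq_or_ne t 0 with rfl | ht
  · rcases Nat.eq_zero_or_pos m with rfl | hm
    · simp
    · have h : κ + m - 1 ≠ 0 := fun h => by
        have h1 := congrArg Complex.re h
        have : (1 : ℝ) ≤ m := by exact_mod_cast hm
        simp at h1
        linarith
      rw [zero_pow hm.ne', zero_mul, Complex.zero_cpow h]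
  · rw [← Complex.cpow_natCast, ← Complex.cpow_add _ _ ht]
    congr 1
    ring

theorem sum_two_mul_perm_add_perm (n : ℕ) (κ : ℂ) (σ τ : Equiv.Perm (Fin n)) :
    ∑ i, (κ + ((2 * (σ i : ℕ) + τ i : ℕ) : ℂ)) =
      ((3 * (n * (n - 1) / 2) : ℕ) : ℂ) + n * κ := by
  have h : ∑ i, (2 * (σ i : ℕ) + τ i) = 3 * (n * (n - 1) / 2) := by
    rw [Finset.sum_add_distrib, ← Finset.mul_sum,
      Equiv.sum_comp σ fun i : Fin n => (i : ℕ), Equiv.sum_comp τ fun i : Fin n => (i : ℕ),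
      Fin.sum_univ_eq_sum_range fun i => i, Finset.sum_range_id]
    ring
  rw [Finset.sum_add_distrib, ← Nat.cast_sum, h]
  simp [add_comm]

/-- The integral formula
`(1/n!) ∫_{Ω_n} D_n(x²) D_n(x) ∏ x_i^{κ-1} dx
  = 2^{n(n-1)/2} (∏_{i=0}^{n-1} i! Γ(κ+2i)) / Γ(3n(n-1)/2 + nκ + 1)`. -/
theorem degree_integral_formula (n : ℕ) (hn : 1 ≤ n) (κ : ℂ) (hκ : 0 < κ.re) :
    (1 / (n.factorial : ℂ)) *
      ∫ x in {x : Fin n → ℝ | (∀ i, 0 ≤ x i) ∧ ∑ i, x i ≤ 1},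
        ((∏ i : Fin n, ∏ j ∈ Finset.Ioi i, ((x i) ^ 2 - (x j) ^ 2) : ℝ) : ℂ) *
          ((∏ i : Fin n, ∏ j ∈ Finset.Ioi i, (x i - x j) : ℝ) : ℂ) *
          ∏ i : Fin n, ((x i : ℂ) ^ (κ - 1)) =
    (2 : ℂ) ^ (n * (n - 1) / 2) *
        (∏ i ∈ Finset.range n, (Nat.factorial i : ℂ) * Complex.Gamma (κ + 2 * i)) /
        Complex.Gamma (((3 * (n * (n - 1) / 2) : ℕ) : ℂ) + n * κ + 1) := by
  change 1 / (n.factorial : ℂ) * ∫ x in cornerSimplex n 1, _ = _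
  have hre (σ τ : Equiv.Perm (Fin n)) (i : Fin n) :
      0 < (κ + ((2 * (σ i : ℕ) + τ i : ℕ) : ℂ)).re := by
    rw [Complex.add_re, Complex.natCast_re]
    positivity
  have hintegrable (σ τ : Equiv.Perm (Fin n)) := integrableOn_cornerSimplex_prod_cpow (hre σ τ) zero_le_one
  have hexp (x : Fin n → ℝ) :
      ((∏ i : Fin n, ∏ j ∈ Finset.Ioi i, ((x i) ^ 2 - (x j) ^ 2) : ℝ) : ℂ) *
          ((∏ i : Fin n, ∏ j ∈ Finset.Ioi i, (x i - x j) : ℝ) : ℂ) *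
          ∏ i : Fin n, ((x i : ℂ) ^ (κ - 1)) =
        ∑ σ : Equiv.Perm (Fin n), ∑ τ : Equiv.Perm (Fin n),
          ((Equiv.Perm.sign σ : ℤ) : ℂ) * ((Equiv.Perm.sign τ : ℤ) : ℂ) *
            ∏ i, (x i : ℂ) ^ (κ + ((2 * (σ i : ℕ) + τ i : ℕ) : ℂ) - 1) := by
    push_cast
    rw [prod_sub_sq_mul_prod_sub_eq_sum, Finset.sum_mul]
    refine Finset.sum_congr rfl fun σ _ => ?_
    rw [Finset.sum_mul]
    refine Finset.sum_congr rfl fun τ _ => ?_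
    rw [mul_assoc, ← Finset.prod_mul_distrib]
    simp only [pow_mul_cpow_sub_one hκ]
    push_cast
    rfl
  simp_rw [hexp]
  rw [integral_finsetSum _ fun σ _ => integrable_finsetSum _ fun τ _ => (hintegrable σ τ).const_mul _]
  have hσ (σ : Equiv.Perm (Fin n)) := integral_finsetSum (μ := volume.restrict (cornerSimplex n 1))
    Finset.univ fun τ _ => (hintegrable σ τ).const_mul
      (((Equiv.Perm.sign σ : ℤ) : ℂ) * ((Equiv.Perm.sign τ : ℤ) : ℂ))
  simp_rw [hσ, integral_const_mul, integral_cornerSimplex_prod_cpow (hre _ _) zero_le_one,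
    sum_two_mul_perm_add_perm, Complex.ofReal_one, Complex.one_cpow, one_mul, ← mul_div_assoc,
    ← Finset.sum_div]
  have hdet := sum_perm_sum_perm_sign_mul_prod
    (Matrix.of fun i j : Fin n => Complex.Gamma (κ + 2 * i + j))
  rw [det_Gamma_two_mul_add n hκ, Fintype.card_fin] at hdet
  simp only [Matrix.of_apply] at hdet
  push_cast
  simp only [← add_assoc]
  rw [hdet]
  have := Nat.cast_ne_zero (R := ℂ).2 n.factorial_ne_zero
  field_simp
end

section
/- Let n ≥ 1 be an integer and let κ be a complex number with Re κ > 0. Then (1/n!) · ∫_{Ω_n} D_n(x²)² · ∏_{i=1}^n x_i^{κ−1} dx = (∏_{i=0}^{n−1} Γ(κ+2i)) / Γ(2n(n−1) + nκ + 1) · det( ((κ+2i−2)_{2j−2}) )_{i,j=1,…,n}, where the determinant is of the n×n matrix whose (i,j) entry is the rising factorial (κ+2i−2)_{2j−2}. -/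
open MeasureTheory Finset

/-- The scaled simplex `{x ≥ 0, ∑ x_i ≤ t}`. -/
def scaledSimplex (n : ℕ) (t : ℝ) : Set (Fin n → ℝ) :=
  {x | (∀ i, 0 ≤ x i) ∧ ∑ i, x i ≤ t}

lemma measurableSet_scaledSimplex (n : ℕ) (t : ℝ) : MeasurableSet (scaledSimplex n t) := by
  refine IsClosed.measurableSet ?_
  simp only [scaledSimplex, Set.ofPred_and, Set.ofPred_forall]
  exact (isClosed_iInter fun i => isClosed_le continuous_const (continuous_apply i)).inter
    (isClosed_le (by fun_prop) continuous_const)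

lemma integrableOn_prod_cpow_scaledSimplex {n : ℕ} (t : ℝ) {a : Fin n → ℂ}
    (ha : ∀ i, 0 < (a i).re) :
    IntegrableOn (fun x : Fin n → ℝ => ∏ i, (x i : ℂ) ^ (a i - 1)) (scaledSimplex n t) := by
  have hbox : IntegrableOn (fun x : Fin n → ℝ => ∏ i, (x i : ℂ) ^ (a i - 1))
      (Set.univ.pi fun _ => Set.Icc 0 t) := by
    rw [IntegrableOn, volume_pi, Measure.restrict_pi_pi]
    refine Integrable.fintype_prod_dep (f := fun i (y : ℝ) => (y : ℂ) ^ (a i - 1)) fun i => ?_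
    rcases le_or_gt 0 t with ht | ht
    · have := intervalIntegral.intervalIntegrable_cpow' (a := 0) (b := t) (r := a i - 1)
        (by simpa using ha i)
      rw [intervalIntegrable_iff_integrableOn_Ioc_of_le ht] at this
      exact (integrableOn_Icc_iff_integrableOn_Ioc (by simp)).2 this
    · simp [Set.Icc_eq_empty_of_lt ht]
  refine hbox.mono_set fun x hx i _ => ⟨hx.1 i, ?_⟩
  exact (single_le_sum (fun j _ => hx.1 j) (mem_univ i)).trans hx.2

lemma cons_mem_scaledSimplex {n : ℕ} {t y : ℝ} {x : Fin n → ℝ} :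
    (Fin.cons y x : Fin (n + 1) → ℝ) ∈ scaledSimplex (n + 1) t ↔
      0 ≤ y ∧ x ∈ scaledSimplex n (t - y) := by
  simp [scaledSimplex, Fin.forall_fin_succ, Fin.sum_univ_succ, and_assoc, le_sub_iff_add_le']

lemma scaledSimplex_eq_empty {n : ℕ} {t : ℝ} (ht : t < 0) : scaledSimplex n t = ∅ := by
  refine Set.eq_empty_of_forall_notMem fun x hx => ?_
  exact absurd ((sum_nonneg fun i _ => hx.1 i).trans hx.2) ht.not_ge

/-- Dirichlet's integral over the simplex, with complex exponents. -/
theorem integral_prod_cpow_scaledSimplex {n : ℕ} (a : Fin n → ℂ) (ha : ∀ i, 0 < (a i).re)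
    {t : ℝ} (ht : 0 < t) :
    ∫ x in scaledSimplex n t, ∏ i, (x i : ℂ) ^ (a i - 1) =
      (t : ℂ) ^ (∑ i, a i) * ((∏ i, Complex.Gamma (a i)) / Complex.Gamma (∑ i, a i + 1)) := by
  induction n generalizing t with
  | zero =>
    have : scaledSimplex 0 t = Set.univ := Set.eq_univ_of_forall fun x => by
      simp [scaledSimplex, ht.le]
    simp [this, volume_pi, measureReal_def]
  | succ n ih =>
    set s := ∑ i : Fin n, a i.succ with hs
    have hs0 : 0 ≤ s.re := by
      rw [hs, Complex.re_sum]
      exact sum_nonneg fun i _ => (ha _).le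
    have hint := (integrable_indicator_iff (measurableSet_scaledSimplex (n + 1) t)).2
      (integrableOn_prod_cpow_scaledSimplex t ha)
    have hmp := (volume_preserving_piFinSuccAbove (fun _ : Fin (n + 1) => ℝ) 0).symm
    have hint' := (hmp.integrable_comp_emb (MeasurableEquiv.measurableEmbedding _)).2 hint
    have hsection : ∀ᵐ y : ℝ, ∫ x : Fin n → ℝ,
        (scaledSimplex (n + 1) t).indicator (fun x => ∏ i, (x i : ℂ) ^ (a i - 1))
          (Fin.cons y x) =
        (Set.Ioc 0 t).indicator (fun y : ℝ => ((y : ℂ) ^ (a 0 - 1) *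
          ((t : ℂ) - y) ^ (s + 1 - 1)) *
            ((∏ i : Fin n, Complex.Gamma (a i.succ)) / Complex.Gamma (s + 1))) y := by
      have h0 : ∀ᵐ y : ℝ, y ≠ 0 := by simp [ae_iff]
      have h1 : ∀ᵐ y : ℝ, y ≠ t := by simp [ae_iff]
      filter_upwards [h0, h1] with y hy0 hyt
      by_cases hy : y ∈ Set.Ioc 0 t
      · have hyt' : 0 < t - y := sub_pos.2 (lt_of_le_of_ne hy.2 hyt)
        have : ∀ x : Fin n → ℝ, (scaledSimplex (n + 1) t).indicator
            (fun x => ∏ i, (x i : ℂ) ^ (a i - 1)) (Fin.cons y x) =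
            (scaledSimplex n (t - y)).indicator (fun x => (y : ℂ) ^ (a 0 - 1) *
              ∏ i, (x i : ℂ) ^ (a i.succ - 1)) x := fun x => by
          classical
          simp only [Set.indicator_apply, cons_mem_scaledSimplex, hy.1.le, true_and,
            Fin.prod_univ_succ, Fin.cons_zero, Fin.cons_succ]
        simp_rw [this]
        rw [integral_indicator (measurableSet_scaledSimplex _ _), integral_const_mul,
          ih _ (fun i => ha _) hyt', Set.indicator_of_mem hy, add_sub_cancel_right]
        push_cast
        ring
      · rw [Set.indicator_of_notMem hy]
        refine integral_eq_zero_of_ae (.of_forall fun x => Set.indicator_of_notMem ?_ _)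
        rw [cons_mem_scaledSimplex]
        rintro ⟨h, hx⟩
        refine hy ⟨lt_of_le_of_ne h hy0.symm, not_lt.1 fun hlt => ?_⟩
        simp [scaledSimplex_eq_empty (sub_neg.2 hlt)] at hx
    have hG : Complex.Gamma (s + 1) ≠ 0 :=
      Complex.Gamma_ne_zero_of_re_pos (by simpa using by linarith)
    have hG' : Complex.Gamma (a 0 + (s + 1)) ≠ 0 :=
      Complex.Gamma_ne_zero_of_re_pos (by have := ha 0; simp; linarith)
    have hbeta := Complex.Gamma_mul_Gamma_eq_betaIntegral (ha 0)
      (t := s + 1) (by simpa using by linarith)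
    rw [← integral_indicator (measurableSet_scaledSimplex _ _),
      ← hmp.integral_comp (MeasurableEquiv.measurableEmbedding _), Measure.volume_eq_prod,
      integral_prod _ (by exact hint')]
    simp only [MeasurableEquiv.piFinSuccAbove_symm_apply, Fin.insertNthEquiv_zero]
    rw [integral_congr_ae (by exact hsection), integral_indicator measurableSet_Ioc, integral_mul_const,
      ← intervalIntegral.integral_of_le ht.le, Complex.betaIntegral_scaled _ _ ht,
      Fin.sum_univ_succ, Fin.prod_univ_succ, ← hs, ← add_assoc, add_sub_cancel_right]
    rw [← add_assoc] at hG' hbeta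
    field_simp
    linear_combination
      (-((t : ℂ) ^ (a 0 + s) * ∏ i : Fin n, Complex.Gamma (a i.succ))) * hbeta

lemma sum_perm_sign_mul_sum_perm_sign {n : ℕ} (m : Fin n → Fin n → ℂ) :
    ∑ σ : Equiv.Perm (Fin n), ∑ τ : Equiv.Perm (Fin n),
      ((σ.sign : ℤ) : ℂ) * ((τ.sign : ℤ) : ℂ) * ∏ i, m (σ i) (τ i) =
      (n.factorial : ℂ) * (Matrix.of m).det := by
  rw [sum_comm]
  have h (τ : Equiv.Perm (Fin n)) : ∑ σ : Equiv.Perm (Fin n),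
      ((σ.sign : ℤ) : ℂ) * ((τ.sign : ℤ) : ℂ) * ∏ i, m (σ i) (τ i) = (Matrix.of m).det := by
    rw [Matrix.det_apply', ← Equiv.sum_comp (Equiv.mulRight τ)]
    refine sum_congr rfl fun ρ _ => ?_
    rw [← Equiv.prod_comp τ (fun i => Matrix.of m (ρ i) i)]
    have : ((τ.sign : ℤ) : ℂ) * ((τ.sign : ℤ) : ℂ) = 1 := by
      exact_mod_cast Int.units_coe_mul_self τ.sign
    simp only [Equiv.coe_mulRight, Equiv.Perm.sign_mul, Units.val_mul, Int.cast_mul,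
      Equiv.Perm.mul_apply, Matrix.of_apply]
    linear_combination (((ρ.sign : ℤ) : ℂ) * ∏ i, m (ρ (τ i)) (τ i)) * this
  simp [h, Fintype.card_perm]

lemma vandermonde_sq_eq_sum {n : ℕ} (x : Fin n → ℝ) :
    ((∏ i : Fin n, ∏ j ∈ Ioi i, (x i ^ 2 - x j ^ 2) : ℝ) : ℂ) ^ 2 =
      ∑ σ : Equiv.Perm (Fin n), ∑ τ : Equiv.Perm (Fin n),
        ((σ.sign : ℤ) : ℂ) * ((τ.sign : ℤ) : ℂ) *
          ∏ i, (x i : ℂ) ^ (2 * (σ i : ℕ) + 2 * (τ i : ℕ)) := by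
  have h : ((∏ i : Fin n, ∏ j ∈ Ioi i, (x i ^ 2 - x j ^ 2) : ℝ) : ℂ) ^ 2 =
      (Matrix.vandermonde fun i => (x i : ℂ) ^ 2).det ^ 2 := by
    rw [Matrix.det_vandermonde]
    push_cast
    simp_rw [← prod_pow]
    exact prod_congr rfl fun i _ => prod_congr rfl fun j _ => by ring
  rw [h, ← Matrix.det_transpose, Matrix.det_apply', sq, sum_mul_sum]
  refine sum_congr rfl fun σ _ => sum_congr rfl fun τ _ => ?_
  simp only [Matrix.transpose_apply, Matrix.vandermonde_apply, pow_add, prod_mul_distrib,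
    pow_mul]
  ring

/-- `(1/n!) ∫_{Ω_n} D_n(x²)² ∏ x_i^{κ-1} dx
  = (∏_{i=0}^{n-1} Γ(κ+2i)) / Γ(2n(n-1) + nκ + 1) · det((κ+2i-2)_{2j-2})_{i,j=1,…,n}`. -/
theorem degree_integral_formula_squared (n : ℕ) (hn : 1 ≤ n) (κ : ℂ) (hκ : 0 < κ.re) :
    (1 / (n.factorial : ℂ)) *
      ∫ x in {x : Fin n → ℝ | (∀ i, 0 ≤ x i) ∧ ∑ i, x i ≤ 1},
        ((∏ i : Fin n, ∏ j ∈ Finset.Ioi i, ((x i) ^ 2 - (x j) ^ 2) : ℝ) : ℂ) ^ 2 *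
          ∏ i : Fin n, ((x i : ℂ) ^ (κ - 1)) =
    (∏ i ∈ Finset.range n, Complex.Gamma (κ + 2 * i)) /
        Complex.Gamma (((2 * (n * (n - 1)) : ℕ) : ℂ) + n * κ + 1) *
      Matrix.det (Matrix.of fun i j : Fin n =>
        (ascPochhammer ℂ (2 * ((j : ℕ) + 1) - 2)).eval
          (κ + 2 * (((i : ℕ) : ℂ) + 1) - 2)) := by
  have hre (k : ℕ) : 0 < (κ + 2 * (k : ℂ)).re := by
    simp
    positivity
  have hnat (k l : ℕ) : κ + 2 * (k : ℂ) ≠ -l := fun h => by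
    have := hre k
    rw [h, Complex.neg_re, Complex.natCast_re] at this
    linarith [l.cast_nonneg (α := ℝ)]
  have hsum (σ τ : Equiv.Perm (Fin n)) :
      ∑ i, (κ + 2 * ((σ i : ℕ) : ℂ) + 2 * ((τ i : ℕ) : ℂ)) =
        ((2 * (n * (n - 1)) : ℕ) : ℂ) + n * κ := by
    have hid : ∑ i : Fin n, ((i : ℕ) : ℂ) * 2 = ((n * (n - 1) : ℕ) : ℂ) := by
      rw [← sum_mul, Fin.sum_univ_eq_sum_range (fun i => (i : ℂ)) n]
      rw [← Nat.cast_sum]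
      exact_mod_cast sum_range_id_mul_two n
    have hperm (ρ : Equiv.Perm (Fin n)) : ∑ i, 2 * ((ρ i : ℕ) : ℂ) = ((n * (n - 1) : ℕ) : ℂ) := by
      rw [← hid, Equiv.sum_comp ρ fun i => 2 * ((i : ℕ) : ℂ)]
      simp_rw [mul_comm]
    rw [sum_add_distrib, sum_add_distrib, hperm, hperm, Nat.cast_mul 2]
    simp
    ring
  have hpos (σ τ : Equiv.Perm (Fin n)) (i : Fin n) :
      0 < (κ + 2 * ((σ i : ℕ) : ℂ) + 2 * ((τ i : ℕ) : ℂ)).re := by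
    simpa [mul_add, add_assoc] using hre ((σ i : ℕ) + (τ i : ℕ))
  have hexpand : ∀ᵐ x : Fin n → ℝ,
      ((∏ i : Fin n, ∏ j ∈ Finset.Ioi i, ((x i) ^ 2 - (x j) ^ 2) : ℝ) : ℂ) ^ 2 *
        ∏ i : Fin n, ((x i : ℂ) ^ (κ - 1)) =
      ∑ σ : Equiv.Perm (Fin n), ∑ τ : Equiv.Perm (Fin n),
        ((σ.sign : ℤ) : ℂ) * ((τ.sign : ℤ) : ℂ) *
          ∏ i, (x i : ℂ) ^ (κ + 2 * ((σ i : ℕ) : ℂ) + 2 * ((τ i : ℕ) : ℂ) - 1) := by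
    have hne : ∀ᵐ x : Fin n → ℝ, ∀ i, x i ≠ 0 := ae_all_iff.2 fun i =>
      Measure.ae_eval_ne _ i 0
    filter_upwards [hne] with x hx
    simp_rw [vandermonde_sq_eq_sum, sum_mul, mul_assoc, ← prod_mul_distrib]
    refine sum_congr rfl fun σ _ => sum_congr rfl fun τ _ => ?_
    congr 2
    refine prod_congr rfl fun i _ => ?_
    rw [← Complex.cpow_natCast, ← Complex.cpow_add _ _ (Complex.ofReal_ne_zero.2 (hx i))]
    congr 1
    push_cast
    ring
  have hterm (σ τ : Equiv.Perm (Fin n)) :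
      IntegrableOn (fun x : Fin n → ℝ => ((σ.sign : ℤ) : ℂ) * ((τ.sign : ℤ) : ℂ) *
          ∏ i, (x i : ℂ) ^ (κ + 2 * ((σ i : ℕ) : ℂ) + 2 * ((τ i : ℕ) : ℂ) - 1))
        (scaledSimplex n 1) :=
    (integrableOn_prod_cpow_scaledSimplex 1 (hpos σ τ)).const_mul _
  have hintegral : ∫ x in scaledSimplex n 1,
        ((∏ i : Fin n, ∏ j ∈ Finset.Ioi i, ((x i) ^ 2 - (x j) ^ 2) : ℝ) : ℂ) ^ 2 *
          ∏ i : Fin n, ((x i : ℂ) ^ (κ - 1)) =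
      (n.factorial : ℂ) * (Matrix.of fun i j : Fin n =>
        Complex.Gamma (κ + 2 * ((i : ℕ) : ℂ) + 2 * ((j : ℕ) : ℂ))).det /
          Complex.Gamma (((2 * (n * (n - 1)) : ℕ) : ℂ) + n * κ + 1) := by
    rw [integral_congr_ae (ae_restrict_of_ae hexpand),
      integral_finsetSum _ fun σ _ => integrable_finsetSum _ fun τ _ => hterm σ τ,
      ← sum_perm_sign_mul_sum_perm_sign, sum_div]
    refine sum_congr rfl fun σ _ => ?_
    rw [integral_finsetSum _ fun τ _ => hterm σ τ, sum_div]
    refine sum_congr rfl fun τ _ => ?_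
    rw [integral_const_mul, integral_prod_cpow_scaledSimplex _ (hpos σ τ) one_pos, hsum,
      Complex.ofReal_one, Complex.one_cpow, one_mul, mul_div_assoc]
  have hdet : (Matrix.of fun i j : Fin n =>
        Complex.Gamma (κ + 2 * ((i : ℕ) : ℂ) + 2 * ((j : ℕ) : ℂ))).det =
      (∏ i ∈ Finset.range n, Complex.Gamma (κ + 2 * i)) *
      Matrix.det (Matrix.of fun i j : Fin n =>
        (ascPochhammer ℂ (2 * ((j : ℕ) + 1) - 2)).eval
          (κ + 2 * (((i : ℕ) : ℂ) + 1) - 2)) := by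
    rw [← Fin.prod_univ_eq_prod_range (fun i => Complex.Gamma (κ + 2 * i)) n,
      ← Matrix.det_mul_column]
    congr 1
    ext i j
    simp only [Matrix.of_apply]
    have hk : κ + 2 * (((i : ℕ) : ℂ) + 1) - 2 = κ + 2 * ((i : ℕ) : ℂ) := by ring
    have hG := Complex.Gamma_ne_zero_of_re_pos (hre i)
    rw [hk, show 2 * ((j : ℕ) + 1) - 2 = 2 * (j : ℕ) by omega,
      ← Complex.Gamma_add_nat_div_Gamma_eq _ (hnat i), mul_div_cancel₀ _ hG]
    push_cast
    rfl
  have hfac : (n.factorial : ℂ) ≠ 0 := by exact_mod_cast n.factorial_ne_zero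
  rw [scaledSimplex] at hintegral
  rw [hintegral, hdet]
  field_simp
end

section
/- Let p, q, n be positive integers with 2n < p and 2n < q, and let X, Y be complex symmetric n×n matrices. In the polynomial ring ℂ[a_{k,i}, b_{l,j} : 1 ≤ k ≤ p, 1 ≤ l ≤ q, 1 ≤ i,j ≤ n], let I be the ideal generated by the polynomials ∑_{k=1}^p a_{k,i} a_{k,j} − X_{i,j} for 1 ≤ i ≤ j ≤ n together with the polynomials ∑_{l=1}^q b_{l,i} b_{l,j} − Y_{i,j} for 1 ≤ i ≤ j ≤ n. Then the quotient ring ℂ[a_{k,i}, b_{l,j}]/I is an integral domain. (That is, the scheme-theoretic fiber of the moment map ψ(A,B) = (AᵀA, BᵀB) over the point (X,Y) is reduced and irreducible.) -/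
open MvPolynomial

/-- The ideal of the scheme-theoretic fiber of the moment map
`ψ(A,B) = (AᵀA, BᵀB)` over the point `(X,Y)`, in the polynomial ring of the
matrix entries of `A ∈ M_{p,n}(ℂ)` and `B ∈ M_{q,n}(ℂ)`. -/
noncomputable def momentFiberIdealOSp (p q n : ℕ) (Xm Ym : Matrix (Fin n) (Fin n) ℂ) :
    Ideal (MvPolynomial ((Fin p × Fin n) ⊕ (Fin q × Fin n)) ℂ) :=
  Ideal.span
    ({f | ∃ i j : Fin n, i ≤ j ∧
        f = (∑ k : Fin p, X (Sum.inl (k, i)) * X (Sum.inl (k, j))) - C (Xm i j)} ∪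
     {f | ∃ i j : Fin n, i ≤ j ∧
        f = (∑ l : Fin q, X (Sum.inr (l, i)) * X (Sum.inr (l, j))) - C (Ym i j)})

section Coaction

variable {P ι : Type*} [CommRing P] {φ : P →+* Polynomial P} {f g : ι → P} {e : ι → ℕ}

/-- Each homogeneous component of an element of the ideal of the `g i` is the top component of
an element of the ideal of the `f i`, where `g i` is the top component of `f i`. -/
theorem exists_mem_span_coeff_eq
    (hφ : ∀ h N, φ ((φ h).coeff N) = Polynomial.monomial N ((φ h).coeff N))
    (hf : ∀ i, (φ (f i)).natDegree ≤ e i) (hg : ∀ i, (φ (f i)).coeff (e i) = g i)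
    (s : Set ι) {u : P} (hu : u ∈ Ideal.span (g '' s)) :
    ∀ N, ∃ v ∈ Ideal.span (f '' s), (φ v).natDegree ≤ N ∧ (φ v).coeff N = (φ u).coeff N := by
  induction hu using Submodule.span_induction with
  | mem x hx =>
    obtain ⟨i, hi, rfl⟩ := hx
    intro N
    have hgi : φ (g i) = Polynomial.monomial (e i) (g i) := by rw [← hg]; exact hφ _ _
    rcases eq_or_ne (e i) N with rfl | hN
    · exact ⟨f i, Ideal.subset_span ⟨i, hi, rfl⟩, hf i, by rw [hgi, hg]; simp⟩
    · exact ⟨0, zero_mem _, by simp, by rw [hgi]; simp [Polynomial.coeff_monomial, hN]⟩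
  | zero => exact fun N => ⟨0, zero_mem _, by simp, rfl⟩
  | add x y _ _ hx hy =>
    intro N
    obtain ⟨v, hv, hvN, hvc⟩ := hx N
    obtain ⟨v', hv', hvN', hvc'⟩ := hy N
    refine ⟨v + v', add_mem hv hv', ?_, by simp [hvc, hvc']⟩
    rw [map_add]
    exact (Polynomial.natDegree_add_le _ _).trans (max_le hvN hvN')
  | smul a x _ hx =>
    intro N
    choose v hv hvN hvc using hx
    refine ⟨∑ kl ∈ Finset.HasAntidiagonal.antidiagonal N, (φ a).coeff kl.1 * v kl.2,
      sum_mem fun kl _ => Ideal.mul_mem_left _ _ (hv _), ?_, ?_⟩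
    · rw [map_sum]
      refine Polynomial.natDegree_sum_le_of_forall_le _ _ fun kl hkl => ?_
      rw [← Finset.HasAntidiagonal.mem_antidiagonal.1 hkl, map_mul, hφ]
      exact Polynomial.natDegree_mul_le_of_le (Polynomial.natDegree_monomial_le _) (hvN _)
    · rw [map_sum, Polynomial.finsetSum_coeff, smul_eq_mul, map_mul, Polynomial.coeff_mul]
      refine Finset.sum_congr rfl fun kl hkl => ?_
      rw [← Finset.HasAntidiagonal.mem_antidiagonal.1 hkl, map_mul, hφ,
        Polynomial.coeff_mul_add_eq_of_natDegree_le (Polynomial.natDegree_monomial_le _) (hvN _),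
        Polynomial.coeff_monomial_same, hvc]

/-- If the top components `g i` of the `f i` form a regular sequence in every order, then they
generate the ideal of top components of the ideal of the `f i`. -/
theorem coeff_mem_span_of_mem_span (hinj : Function.Injective φ)
    (hφ : ∀ h N, φ ((φ h).coeff N) = Polynomial.monomial N ((φ h).coeff N))
    (hf : ∀ i, (φ (f i)).natDegree ≤ e i) (hg : ∀ i, (φ (f i)).coeff (e i) = g i)
    (hreg : ∀ (s : Set ι) (i : ι), i ∉ s → ∀ h, h * g i ∈ Ideal.span (g '' s) →
      h ∈ Ideal.span (g '' s)) (s : Finset ι) :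
    ∀ h ∈ Ideal.span (f '' (s : Set ι)), ∀ N, (φ h).natDegree ≤ N →
      (φ h).coeff N ∈ Ideal.span (g '' (s : Set ι)) := by
  classical
  induction s using Finset.induction_on with
  | empty => simp
  | insert m s hm ih =>
    rw [Finset.coe_insert, Set.image_insert_eq, Set.image_insert_eq]
    have hsub : Ideal.span (g '' (s : Set ι)) ≤ Ideal.span (insert (g m) (g '' (s : Set ι))) :=
      Ideal.span_mono (Set.subset_insert _ _)
    have key : ∀ M : ℕ, ∀ c, (φ c).degree < M → ∀ h' ∈ Ideal.span (f '' (s : Set ι)), ∀ N,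
        (φ (c * f m + h')).natDegree ≤ N →
        (φ (c * f m + h')).coeff N ∈ Ideal.span (insert (g m) (g '' (s : Set ι))) := by
      intro M
      induction M with
      | zero =>
        intro c hc h' hh' N hN
        have : c = 0 := by
          apply hinj
          rw [map_zero, ← Polynomial.degree_eq_bot]
          simpa using hc
        subst this
        rw [zero_mul, zero_add] at hN ⊢
        exact hsub (ih _ hh' _ hN)
      | succ M ihM =>
        intro c hc h' hh' N hN
        have hcM : (φ c).natDegree ≤ M := by
          rw [Polynomial.natDegree_le_iff_degree_le]
          exact Polynomial.degree_le_of_natDegree_le (by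
            rcases eq_or_ne (φ c) 0 with h0 | h0
            · simp [h0]
            · rw [← Nat.lt_succ_iff]; exact (Polynomial.natDegree_lt_iff_degree_lt h0).2 hc)
        have hcf : (φ (c * f m)).natDegree ≤ M + e m := by
          rw [map_mul]; exact Polynomial.natDegree_mul_le_of_le hcM (hf m)
        have hh'eq : φ h' = φ (c * f m + h') - φ (c * f m) := by rw [map_add]; ring
        by_cases hle : M + e m ≤ N
        · have h1 : (φ h').natDegree ≤ N := by
            rw [hh'eq]
            exact (Polynomial.natDegree_sub_le _ _).trans (max_le hN (hcf.trans hle))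
          rw [map_add, Polynomial.coeff_add]
          refine add_mem ?_ (hsub (ih _ hh' _ h1))
          obtain ⟨k, rfl⟩ := Nat.exists_eq_add_of_le' ((Nat.le_add_left _ _).trans hle)
          rw [map_mul,
            Polynomial.coeff_mul_add_eq_of_natDegree_le (hcM.trans (by omega)) (hf m), hg]
          exact Ideal.mul_mem_left _ _ (Ideal.subset_span (Set.mem_insert _ _))
        · have h1 : (φ h').natDegree ≤ M + e m := by
            rw [hh'eq]
            exact (Polynomial.natDegree_sub_le _ _).trans (max_le (hN.trans (by omega)) hcf)
          have h2 := ih _ hh' _ h1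
          rw [hh'eq, Polynomial.coeff_sub, Polynomial.coeff_eq_zero_of_natDegree_lt
            (lt_of_le_of_lt hN (by omega)), zero_sub, neg_mem_iff, map_mul,
            Polynomial.coeff_mul_add_eq_of_natDegree_le hcM (hf m), hg] at h2
          obtain ⟨v, hv, hvM, hvc⟩ := exists_mem_span_coeff_eq hφ hf hg _
            (hreg s m (by simpa using hm) _ h2) M
          rw [hφ, Polynomial.coeff_monomial_same] at hvc
          have hdeg : (φ (c - v)).degree < M := by
            rw [Polynomial.degree_lt_iff_coeff_zero]
            intro k hk
            rw [map_sub, Polynomial.coeff_sub]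
            rcases hk.eq_or_lt with rfl | hk
            · rw [hvc, sub_self]
            · rw [Polynomial.coeff_eq_zero_of_natDegree_lt (hcM.trans_lt hk),
                Polynomial.coeff_eq_zero_of_natDegree_lt (hvM.trans_lt hk), sub_self]
          have := ihM (c - v) hdeg (h' + v * f m) (add_mem hh' (Ideal.mul_mem_right _ _ hv)) N
          rw [show (c - v) * f m + (h' + v * f m) = c * f m + h' by ring] at this
          exact this hN
    intro h hh N hN
    obtain ⟨c, h', hh', rfl⟩ := Ideal.mem_span_insert.1 hh
    exact key ((φ c).natDegree + 1) c
      (Polynomial.degree_le_natDegree.trans_lt (by exact_mod_cast Nat.lt_succ_self _)) h' hh' N hN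

theorem mem_span_of_mul_mem_span [Finite ι] (hinj : Function.Injective φ)
    (hφ : ∀ h N, φ ((φ h).coeff N) = Polynomial.monomial N ((φ h).coeff N))
    (hf : ∀ i, (φ (f i)).natDegree ≤ e i) (hg : ∀ i, (φ (f i)).coeff (e i) = g i)
    (hreg : ∀ (s : Set ι) (i : ι), i ∉ s → ∀ h, h * g i ∈ Ideal.span (g '' s) →
      h ∈ Ideal.span (g '' s)) {d : P} {E : ℕ} (hd : (φ d).natDegree ≤ E)
    (hdreg : ∀ h, h * (φ d).coeff E ∈ Ideal.span (Set.range g) → h ∈ Ideal.span (Set.range g))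
    {h : P} (hh : h * d ∈ Ideal.span (Set.range f)) : h ∈ Ideal.span (Set.range f) := by
  classical
  cases nonempty_fintype ι
  have hA := coeff_mem_span_of_mem_span hinj hφ hf hg hreg Finset.univ
  have hB := fun u => exists_mem_span_coeff_eq hφ hf hg Set.univ (u := u)
  simp only [Finset.coe_univ, Set.image_univ] at hA hB
  have key : ∀ M : ℕ, ∀ c, (φ c).degree < M → c * d ∈ Ideal.span (Set.range f) →
      c ∈ Ideal.span (Set.range f) := by
    intro M
    induction M with
    | zero =>
      intro c hc _
      have : c = 0 := by
        apply hinj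
        rw [map_zero, ← Polynomial.degree_eq_bot]
        simpa using hc
      simp [this]
    | succ M ihM =>
      intro c hc hcd
      have hcM : (φ c).natDegree ≤ M := by
        rcases eq_or_ne (φ c) 0 with h0 | h0
        · simp [h0]
        · rw [← Nat.lt_succ_iff]; exact (Polynomial.natDegree_lt_iff_degree_lt h0).2 hc
      have h2 := hA _ hcd (M + E) (by
        rw [map_mul]; exact Polynomial.natDegree_mul_le_of_le hcM hd)
      rw [map_mul, Polynomial.coeff_mul_add_eq_of_natDegree_le hcM hd] at h2
      obtain ⟨v, hv, hvM, hvc⟩ := hB _ (hdreg _ h2) M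
      rw [hφ, Polynomial.coeff_monomial_same] at hvc
      have hdeg : (φ (c - v)).degree < M := by
        rw [Polynomial.degree_lt_iff_coeff_zero]
        intro k hk
        rw [map_sub, Polynomial.coeff_sub]
        rcases hk.eq_or_lt with rfl | hk
        · rw [hvc, sub_self]
        · rw [Polynomial.coeff_eq_zero_of_natDegree_lt (hcM.trans_lt hk),
            Polynomial.coeff_eq_zero_of_natDegree_lt (hvM.trans_lt hk), sub_self]
      have := ihM (c - v) hdeg (by rw [sub_mul]; exact sub_mem hcd (Ideal.mul_mem_right _ _ hv))
      simpa using add_mem this hv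
  exact key ((φ h).natDegree + 1) h
    (Polynomial.degree_le_natDegree.trans_lt (by exact_mod_cast Nat.lt_succ_self _)) hh

end Coaction

section Weight

variable {K σ ι : Type*} [CommRing K]

/-- The grading by the weights `w`, as the coaction `X v ↦ X v * T ^ w v`. -/
noncomputable def weightCoaction (K : Type*) [CommRing K] (w : σ → ℕ) :
    MvPolynomial σ K →ₐ[K] Polynomial (MvPolynomial σ K) :=
  aeval fun v => Polynomial.monomial (w v) (X v)

theorem weightCoaction_X (w : σ → ℕ) (v : σ) :
    weightCoaction K w (X v) = Polynomial.monomial (w v) (X v) := by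
  simp [weightCoaction]

theorem weightCoaction_C (w : σ → ℕ) (c : K) :
    weightCoaction K w (C c) = Polynomial.monomial 0 (C c) := by
  rw [weightCoaction, aeval_C]; rfl

theorem weightCoaction_monomial (w : σ → ℕ) (m : σ →₀ ℕ) (c : K) :
    weightCoaction K w (monomial m c) =
      Polynomial.monomial (Finsupp.weight w m) (monomial m c) := by
  induction m using Finsupp.induction_linear generalizing c with
  | zero => simp
  | add m m' h h' =>
    rw [← mul_one c, ← monomial_mul, map_mul, h, h', Polynomial.monomial_mul_monomial, map_add]
  | single v k =>
    rw [← C_mul_X_pow_eq_monomial, map_mul, map_pow, weightCoaction_C, weightCoaction_X,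
      Polynomial.monomial_pow, Polynomial.monomial_mul_monomial]
    simp [Finsupp.weight_single, mul_comm]

theorem weightCoaction_injective (w : σ → ℕ) : Function.Injective (weightCoaction K w) := by
  refine Function.LeftInverse.injective (g := Polynomial.eval 1) fun h => ?_
  induction h using MvPolynomial.induction_on' with
  | monomial m c => simp [weightCoaction_monomial]
  | add p q hp hq => rw [map_add, Polynomial.eval_add, hp, hq]

theorem weightCoaction_coeff (w : σ → ℕ) (h : MvPolynomial σ K) (N : ℕ) :
    weightCoaction K w ((weightCoaction K w h).coeff N) =
      Polynomial.monomial N ((weightCoaction K w h).coeff N) := by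
  induction h using MvPolynomial.induction_on' with
  | monomial m c =>
    rw [weightCoaction_monomial, Polynomial.coeff_monomial]
    split_ifs with h
    · rw [weightCoaction_monomial, h]
    · simp
  | add p q hp hq => rw [map_add, Polynomial.coeff_add, map_add, hp, hq, map_add]

theorem mem_span_monomial_of_mul_mem {m : σ →₀ ℕ} {S : Set (σ →₀ ℕ)}
    (hS : ∀ m' ∈ S, Disjoint m.support m'.support) {h : MvPolynomial σ K}
    (hh : h * monomial m 1 ∈ Ideal.span ((fun m' => monomial m' (1 : K)) '' S)) :
    h ∈ Ideal.span ((fun m' => monomial m' (1 : K)) '' S) := by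
  rw [mem_ideal_span_monomial_image] at hh ⊢
  intro a ha
  obtain ⟨m', hm', hle⟩ := hh (a + m) (by
    rw [mem_support_iff, coeff_mul_monomial, mul_one]; exact mem_support_iff.1 ha)
  refine ⟨m', hm', fun v => ?_⟩
  by_cases hv : v ∈ m'.support
  · have : m v = 0 := Finsupp.notMem_support_iff.1 (Finset.disjoint_right.1 (hS _ hm') hv)
    simpa [this] using hle v
  · simp [Finsupp.notMem_support_iff.1 hv]

/-- If the top weighted components of `f i` and `d` are monomials in pairwise disjoint sets of
variables, then `d` is a nonzerodivisor modulo the ideal generated by the `f i`. -/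
theorem mem_span_of_mul_mem_of_disjoint [Finite ι] (w : σ → ℕ) {f : ι → MvPolynomial σ K}
    {e : ι → ℕ} {m : ι → σ →₀ ℕ} (hf : ∀ i, (weightCoaction K w (f i)).natDegree ≤ e i)
    (hm : ∀ i, (weightCoaction K w (f i)).coeff (e i) = monomial (m i) 1)
    (hdisj : Pairwise fun i j => Disjoint (m i).support (m j).support)
    {d : MvPolynomial σ K} {E : ℕ} {m' : σ →₀ ℕ} (hd : (weightCoaction K w d).natDegree ≤ E)
    (hdm : (weightCoaction K w d).coeff E = monomial m' 1)
    (hddisj : ∀ i, Disjoint m'.support (m i).support)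
    {h : MvPolynomial σ K} (hh : h * d ∈ Ideal.span (Set.range f)) :
    h ∈ Ideal.span (Set.range f) := by
  refine mem_span_of_mul_mem_span (φ := (weightCoaction K w).toRingHom)
    (g := (fun m' => monomial m' (1 : K)) ∘ m) (weightCoaction_injective w)
    (weightCoaction_coeff w) hf hm ?_ hd ?_ hh
  · intro s i hi h hh
    rw [Set.image_comp] at hh ⊢
    refine mem_span_monomial_of_mul_mem ?_ hh
    rintro _ ⟨j, hj, rfl⟩
    exact hdisj (by rintro rfl; exact hi hj)
  · intro h hh
    rw [AlgHom.toRingHom_eq_coe, AlgHom.coe_toRingHom, hdm, Set.range_comp] at hh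
    rw [Set.range_comp]
    refine mem_span_monomial_of_mul_mem ?_ hh
    rintro _ ⟨j, rfl⟩
    exact hddisj j

end Weight

section LeadingTerm

variable {K σ ι : Type*} [CommRing K] {w : σ → ℕ}

/-- `h` has weighted degree at most `e`, and its component of weight `e` is `u`. -/
def HasTopComponent (w : σ → ℕ) (h : MvPolynomial σ K) (e : ℕ) (u : MvPolynomial σ K) : Prop :=
  (weightCoaction K w h).natDegree ≤ e ∧ (weightCoaction K w h).coeff e = u

namespace HasTopComponent

variable {h h' u u' : MvPolynomial σ K} {e e' : ℕ}

theorem add (H : HasTopComponent w h e u) (H' : HasTopComponent w h' e u') :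
    HasTopComponent w (h + h') e (u + u') := by
  refine ⟨?_, by rw [map_add, Polynomial.coeff_add, H.2, H'.2]⟩
  rw [map_add]
  exact (Polynomial.natDegree_add_le _ _).trans (max_le H.1 H'.1)

theorem sub (H : HasTopComponent w h e u) (H' : HasTopComponent w h' e u') :
    HasTopComponent w (h - h') e (u - u') := by
  refine ⟨?_, by rw [map_sub, Polynomial.coeff_sub, H.2, H'.2]⟩
  rw [map_sub]
  exact (Polynomial.natDegree_sub_le _ _).trans (max_le H.1 H'.1)

theorem sum {α : Type*} {s : Finset α} {h u : α → MvPolynomial σ K}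
    (H : ∀ a ∈ s, HasTopComponent w (h a) e (u a)) :
    HasTopComponent w (∑ a ∈ s, h a) e (∑ a ∈ s, u a) := by
  refine ⟨?_, ?_⟩
  · rw [map_sum]
    exact Polynomial.natDegree_sum_le_of_forall_le _ _ fun a ha => (H a ha).1
  · rw [map_sum, Polynomial.finsetSum_coeff]
    exact Finset.sum_congr rfl fun a ha => (H a ha).2

theorem smul (H : HasTopComponent w h e u) (z : ℤˣ) : HasTopComponent w (z • h) e (z • u) := by
  obtain rfl | rfl := Int.units_eq_one_or z
  · simpa using H
  · simpa [HasTopComponent] using H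

theorem mul (H : HasTopComponent w h e u) (H' : HasTopComponent w h' e' u') :
    HasTopComponent w (h * h') (e + e') (u * u') := by
  rw [HasTopComponent, map_mul]
  exact ⟨Polynomial.natDegree_mul_le_of_le H.1 H'.1, by
    rw [Polynomial.coeff_mul_add_eq_of_natDegree_le H.1 H'.1, H.2, H'.2]⟩

theorem X (v : σ) : HasTopComponent w (X v : MvPolynomial σ K) (w v) (MvPolynomial.X v) := by
  rw [HasTopComponent, weightCoaction_X]
  exact ⟨Polynomial.natDegree_monomial_le _, Polynomial.coeff_monomial_same _ _⟩

theorem C (c : K) : HasTopComponent w (C c) 0 (MvPolynomial.C c) := by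
  rw [HasTopComponent, weightCoaction_C]
  exact ⟨Polynomial.natDegree_monomial_le _, Polynomial.coeff_monomial_same _ _⟩

theorem prod {α : Type*} {s : Finset α} {h u : α → MvPolynomial σ K} {e : α → ℕ}
    (H : ∀ a ∈ s, HasTopComponent w (h a) (e a) (u a)) :
    HasTopComponent w (∏ a ∈ s, h a) (∑ a ∈ s, e a) (∏ a ∈ s, u a) := by
  classical
  induction s using Finset.induction_on with
  | empty => simpa using C (w := w) (1 : K)
  | insert a s ha ih =>
    rw [Finset.prod_insert ha, Finset.sum_insert ha, Finset.prod_insert ha]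
    exact (H a (Finset.mem_insert_self _ _)).mul
      (ih fun b hb => H b (Finset.mem_insert_of_mem hb))

theorem of_lt (H : HasTopComponent w h e u) (he : e < e') : HasTopComponent w h e' 0 :=
  ⟨H.1.trans he.le, Polynomial.coeff_eq_zero_of_natDegree_lt (H.1.trans_lt he)⟩

end HasTopComponent

end LeadingTerm

section IsotropicCoordinates

variable {K : Type*} [CommRing K] {n s : ℕ}

/-- Coordinates of `n` vectors in a quadratic space which is an orthogonal sum of `n` hyperbolic
planes and an `(s + 1)`-dimensional space with an orthonormal basis. -/
abbrev IsotropicCoord (n s : ℕ) : Type := Fin n × (Fin n ⊕ Fin n ⊕ Fin (s + 1))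

/-- The inner product of the `i`-th and `j`-th generic vectors, minus its prescribed value. -/
noncomputable def isotropicForm (s : ℕ) (M : Matrix (Fin n) (Fin n) K) (i j : Fin n) :
    MvPolynomial (IsotropicCoord n s) K :=
  ∑ k, (X (i, .inl k) * X (j, .inr (.inl k)) + X (i, .inr (.inl k)) * X (j, .inl k)) +
    ∑ l, X (i, .inr (.inr l)) * X (j, .inr (.inr l)) - C (M i j)

/-- Weights making the top components of the polynomials `isotropicForm s M i j` with `i ≤ j`
monomials without common variables. -/
def isotropicWeight : IsotropicCoord n s → ℕ
  | (i, .inl k) => 2 * n ^ 2 + 3 * n + 2 * k * i + 3 * i - (k ^ 2 + 2 * k)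
  | (i, .inr (.inl k)) => 2 * n ^ 2 + 3 * n - (2 * k * i + 3 * i)
  | (_, .inr (.inr l)) => 2 * n ^ 2 + 3 * n + if l = 0 then 1 else 0

theorem isotropicWeight_inl (i k : Fin n) :
    (isotropicWeight (s := s) (i, .inl k) : ℤ) =
      2 * n ^ 2 + 3 * n + 2 * k * i + 3 * i - (k ^ 2 + 2 * k) := by
  have hk : (k : ℕ) < n := k.2
  rw [isotropicWeight, Nat.cast_sub (by nlinarith)]
  push_cast; ring

theorem isotropicWeight_inr_inl (i k : Fin n) :
    (isotropicWeight (s := s) (i, .inr (.inl k)) : ℤ) =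
      2 * n ^ 2 + 3 * n - (2 * k * i + 3 * i) := by
  have hk : (k : ℕ) < n := k.2
  have hi : (i : ℕ) < n := i.2
  rw [isotropicWeight, Nat.cast_sub (by nlinarith [Nat.mul_le_mul hk.le hi.le])]
  push_cast; ring

theorem isotropicWeight_inr_inr (i : Fin n) (l : Fin (s + 1)) :
    isotropicWeight (i, .inr (.inr l)) = 2 * n ^ 2 + 3 * n + if l = 0 then 1 else 0 := rfl

theorem hasTopComponent_isotropicForm_self (M : Matrix (Fin n) (Fin n) K) (i : Fin n) :
    HasTopComponent isotropicWeight (isotropicForm s M i i) (4 * n ^ 2 + 6 * n + 2)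
      (monomial (Finsupp.single (i, .inr (.inr 0)) 2) 1) := by
  have h : HasTopComponent isotropicWeight (isotropicForm s M i i) (4 * n ^ 2 + 6 * n + 2)
      (∑ k : Fin n, ((0 : MvPolynomial (IsotropicCoord n s) K) + 0) +
        ∑ l : Fin (s + 1),
          (if l = 0 then X (i, .inr (.inr l)) * X (i, .inr (.inr l)) else 0) - 0) := by
    refine ((HasTopComponent.sum fun k _ => .add ?_ ?_).add (.sum fun l _ => ?_)).sub
      ((HasTopComponent.C _).of_lt (by omega))
    · refine ((HasTopComponent.X _).mul (.X _)).of_lt ?_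
      zify
      rw [isotropicWeight_inl, isotropicWeight_inr_inl]
      nlinarith
    · refine ((HasTopComponent.X _).mul (.X _)).of_lt ?_
      zify
      rw [isotropicWeight_inl, isotropicWeight_inr_inl]
      nlinarith
    · have := (HasTopComponent.X (K := K) (w := isotropicWeight) (i, .inr (.inr l))).mul
        (.X (i, .inr (.inr l)))
      rw [isotropicWeight_inr_inr] at this
      split_ifs at this ⊢ with hl
      · convert this using 1; ring
      · exact this.of_lt (by linarith)
  convert h using 1
  simp only [add_zero, Finset.sum_const_zero, zero_add, sub_zero, Finset.sum_ite_eq',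
    Finset.mem_univ, if_true]
  rw [← X_pow_eq_monomial, sq]

theorem hasTopComponent_isotropicForm_of_lt (M : Matrix (Fin n) (Fin n) K) {i j k₀ : Fin n}
    (hk₀ : (j : ℕ) = i + k₀ + 1) :
    HasTopComponent isotropicWeight (isotropicForm s M i j)
      (4 * n ^ 2 + 6 * n + k₀ ^ 2 + 3 * (j - i))
      (monomial (Finsupp.single (i, .inr (.inl k₀)) 1 + Finsupp.single (j, .inl k₀) 1) 1) := by
  have hji : (j : ℕ) - i = k₀ + 1 := by omega
  rw [hji]
  have hj : (j : ℤ) = i + k₀ + 1 := by exact_mod_cast hk₀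
  have h : HasTopComponent isotropicWeight (isotropicForm s M i j)
      (4 * n ^ 2 + 6 * n + k₀ ^ 2 + 3 * (k₀ + 1))
      (∑ k : Fin n, ((0 : MvPolynomial (IsotropicCoord n s) K) + if k = k₀ then
        X (i, .inr (.inl k)) * X (j, .inl k) else 0) + ∑ l : Fin (s + 1), 0 - 0) := by
    refine ((HasTopComponent.sum fun k _ => .add ?_ ?_).add (.sum fun l _ => ?_)).sub
      ((HasTopComponent.C _).of_lt (by omega))
    · refine ((HasTopComponent.X _).mul (.X _)).of_lt ?_
      zify
      rw [isotropicWeight_inl, isotropicWeight_inr_inl, hj]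
      nlinarith [mul_nonneg (Int.natCast_nonneg (k : ℕ)) (Int.natCast_nonneg (k₀ : ℕ))]
    · have := (HasTopComponent.X (K := K) (w := isotropicWeight (s := s))
        (i, .inr (.inl k))).mul (.X (j, .inl k))
      split_ifs with hl
      · subst hl
        convert this using 1
        zify
        rw [isotropicWeight_inl, isotropicWeight_inr_inl, hj]
        ring
      · refine this.of_lt ?_
        zify
        rw [isotropicWeight_inl, isotropicWeight_inr_inl, hj]
        have : ((k : ℕ) : ℤ) - (k₀ : ℕ) ≠ 0 := by
          rw [sub_ne_zero]; exact_mod_cast Fin.val_ne_of_ne hl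
        nlinarith [sq_pos_of_ne_zero this]
    · refine ((HasTopComponent.X _).mul (.X _)).of_lt ?_
      rw [isotropicWeight_inr_inr, isotropicWeight_inr_inr]
      split_ifs <;> nlinarith
  convert h using 1
  simp only [Finset.sum_const_zero, zero_add, add_zero, sub_zero, Finset.sum_ite_eq',
    Finset.mem_univ, if_true]
  rw [X, X, monomial_mul, one_mul]

/-- The generic square matrix of the isotropic coordinates. -/
noncomputable def isotropicMatrix (K : Type*) [CommRing K] (n s : ℕ) :
    Matrix (Fin n) (Fin n) (MvPolynomial (IsotropicCoord n s) K) :=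
  .of fun i k => X (i, .inl k)

theorem hasTopComponent_det_isotropicMatrix :
    HasTopComponent isotropicWeight (isotropicMatrix K n s).det
      (∑ i : Fin n, isotropicWeight (s := s) (i, .inl i))
      (monomial (∑ i : Fin n, Finsupp.single (i, .inl i) 1) 1) := by
  rw [Matrix.det_apply]
  have h : HasTopComponent isotropicWeight
      (∑ τ : Equiv.Perm (Fin n), Equiv.Perm.sign τ • ∏ i, isotropicMatrix K n s (τ i) i)
      (∑ i : Fin n, isotropicWeight (s := s) (i, .inl i))
      (∑ τ : Equiv.Perm (Fin n), if τ = 1 then Equiv.Perm.sign τ •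
        ∏ i : Fin n, (X (τ i, .inl i) : MvPolynomial (IsotropicCoord n s) K) else 0) := by
    refine .sum fun τ _ => ?_
    have := (HasTopComponent.prod (s := Finset.univ) fun i _ => HasTopComponent.X (K := K)
      (w := isotropicWeight (s := s)) (τ i, .inl i)).smul (Equiv.Perm.sign τ)
    split_ifs with hτ
    · subst hτ; exact this
    · refine this.of_lt ?_
      zify
      simp only [isotropicWeight_inl]
      rw [← sub_pos, ← Finset.sum_sub_distrib]
      have h1 : ∑ i : Fin n, (3 * ((τ i : ℕ) : ℤ) + (τ i : ℕ) ^ 2) =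
          ∑ i : Fin n, (3 * ((i : ℕ) : ℤ) + (i : ℕ) ^ 2) :=
        Equiv.sum_comp τ fun i : Fin n => 3 * ((i : ℕ) : ℤ) + (i : ℕ) ^ 2
      have h2 : 0 < ∑ i : Fin n, (((i : ℕ) : ℤ) - (τ i : ℕ)) ^ 2 := by
        obtain ⟨i, hi⟩ : ∃ i, τ i ≠ i := by
          by_contra! hc
          exact hτ (Equiv.ext hc)
        refine Finset.sum_pos' (fun _ _ => sq_nonneg _) ⟨i, Finset.mem_univ _, ?_⟩
        refine sq_pos_of_ne_zero (sub_ne_zero.2 ?_)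
        exact_mod_cast (Fin.val_ne_of_ne hi).symm
      rw [← sub_eq_zero, ← Finset.sum_sub_distrib] at h1
      refine h2.trans_eq ?_
      rw [← sub_zero (∑ i : Fin n, (((i : ℕ) : ℤ) - (τ i : ℕ)) ^ 2), ← h1,
        ← Finset.sum_sub_distrib]
      exact Finset.sum_congr rfl fun i _ => by ring
  convert h using 1
  simp only [Finset.sum_ite_eq', Finset.mem_univ, if_true, Equiv.Perm.sign_one, one_smul,
    Equiv.Perm.one_apply]
  exact monomial_sum_one _ _

/-- The ideal of the fibre over `M`, in isotropic coordinates. -/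
noncomputable def isotropicIdeal (s : ℕ) (M : Matrix (Fin n) (Fin n) K) :
    Ideal (MvPolynomial (IsotropicCoord n s) K) :=
  Ideal.span (Set.range fun ij : {ij : Fin n × Fin n // ij.1 ≤ ij.2} =>
    isotropicForm s M ij.1.1 ij.1.2)

theorem mem_isotropicIdeal_of_mul_det_mem {M : Matrix (Fin n) (Fin n) K}
    {h : MvPolynomial (IsotropicCoord n s) K}
    (hh : h * (isotropicMatrix K n s).det ∈ isotropicIdeal s M) : h ∈ isotropicIdeal s M := by
  classical
  have key : ∀ ij : {ij : Fin n × Fin n // ij.1 ≤ ij.2}, ∃ (e : ℕ) (m : IsotropicCoord n s →₀ ℕ),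
      HasTopComponent isotropicWeight (isotropicForm s M ij.1.1 ij.1.2) e (monomial m 1) ∧
      ∀ v ∈ m.support, match v with
        | (i, .inl k) => ij.1.2 = i ∧ (i : ℕ) = ij.1.1 + k + 1
        | (i, .inr (.inl k)) => ij.1.1 = i ∧ (ij.1.2 : ℕ) = i + k + 1
        | (i, .inr (.inr _)) => ij.1.1 = i ∧ ij.1.2 = i := by
    rintro ⟨⟨i, j⟩, hij⟩
    rcases hij.eq_or_lt with heq | hlt
    · obtain rfl : i = j := heq
      refine ⟨_, _, hasTopComponent_isotropicForm_self M i, fun v hv => ?_⟩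
      obtain rfl := Finset.mem_singleton.1 (Finsupp.support_single_subset hv)
      exact ⟨rfl, rfl⟩
    · have hlt' : (i : ℕ) < j := hlt
      have hk₀ : (j : ℕ) = i + (⟨j - i - 1, by omega⟩ : Fin n) + 1 := by
        simp only; omega
      refine ⟨_, _, hasTopComponent_isotropicForm_of_lt M hk₀, fun v hv => ?_⟩
      rcases Finset.mem_union.1 (Finsupp.support_add hv) with hv | hv <;>
      obtain rfl := Finset.mem_singleton.1 (Finsupp.support_single_subset hv)
      · exact ⟨rfl, hk₀⟩
      · exact ⟨rfl, hk₀⟩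
  choose e m hm hsupp using key
  have hdet := hasTopComponent_det_isotropicMatrix (K := K) (n := n) (s := s)
  refine mem_span_of_mul_mem_of_disjoint isotropicWeight (fun ij => (hm ij).1)
    (fun ij => (hm ij).2) (fun ij ij' hne => ?_) hdet.1 hdet.2 (fun ij => ?_) hh
  · refine Finset.disjoint_left.2 fun v hv hv' => hne ?_
    have h1 := hsupp _ v hv
    have h2 := hsupp _ v hv'
    obtain ⟨⟨i, j⟩, _⟩ := ij
    obtain ⟨⟨i', j'⟩, _⟩ := ij'
    obtain ⟨a, k | k | l⟩ := v <;> simp only [Subtype.mk.injEq, Prod.mk.injEq] at h1 h2 ⊢ <;>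
      omega
  · refine Finset.disjoint_left.2 fun v hv hv' => ?_
    have h2 := hsupp _ v hv'
    obtain ⟨a, -, ha⟩ := Finset.mem_biUnion.1 (Finsupp.support_finsetSum hv)
    obtain rfl := Finset.mem_singleton.1 (Finsupp.support_single_subset ha)
    simp only at h2
    omega

end IsotropicCoordinates

section Localization

variable {K : Type*} [CommRing K] {n s : ℕ}

/-- Coordinates on the open subset of the fibre where `isotropicMatrix` is invertible. -/
abbrev ChartCoord (n s : ℕ) : Type :=
  (Fin n × (Fin n ⊕ Fin (s + 1))) ⊕ {ij : Fin n × Fin n // ij.2 < ij.1}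

/-- The chart coordinates as functions of the isotropic coordinates. -/
noncomputable def chartHom (K : Type*) [CommRing K] (n s : ℕ) :
    MvPolynomial (ChartCoord n s) K →ₐ[K] MvPolynomial (IsotropicCoord n s) K :=
  aeval fun
    | .inl (i, .inl k) => X (i, .inl k)
    | .inl (i, .inr l) => X (i, .inr (.inr l))
    | .inr ij => ∑ k, X (ij.1.1, .inl k) * X (ij.1.2, .inr (.inl k))

theorem exists_chart_retraction [IsDomain K] {c : K} (hc : 2 * c = 1)
    {M : Matrix (Fin n) (Fin n) K} (hM : M.IsSymm) :
    ∃ ψ : MvPolynomial (IsotropicCoord n s) K →ₐ[K]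
        FractionRing (MvPolynomial (ChartCoord n s) K),
      isotropicIdeal s M ≤ RingHom.ker ψ ∧
        ∀ q, ψ (chartHom K n s q) = algebraMap _ _ q := by
  set Q := MvPolynomial (ChartCoord n s) K
  set L := FractionRing Q
  let x : Matrix (Fin n) (Fin n) L := .of fun i k => algebraMap Q L (X (.inl (i, .inl k)))
  let z : Fin n → Fin (s + 1) → L := fun i l => algebraMap Q L (X (.inl (i, .inr l)))
  let S : Matrix (Fin n) (Fin n) L :=
    .of fun i j => algebraMap K L (M i j) - ∑ l, z i l * z j l
  have hS : ∀ i j, S i j = S j i := fun i j => by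
    simp only [S, Matrix.of_apply, hM.apply i j, mul_comm (z i _)]
  let W : Matrix (Fin n) (Fin n) L := .of fun i j =>
    if h : j < i then algebraMap Q L (X (.inr ⟨(i, j), h⟩))
    else if h' : i < j then S i j - algebraMap Q L (X (.inr ⟨(j, i), h'⟩))
    else algebraMap K L c * S i j
  have hW : ∀ i j, W i j + W j i = S i j := by
    have hcL : 2 * algebraMap K L c = 1 := by
      rw [← map_ofNat (algebraMap K L) 2, ← map_mul, hc, map_one]
    intro i j
    rcases lt_trichotomy i j with h | rfl | h
    · simp [W, h, h.not_gt]
    · simp only [W, Matrix.of_apply, lt_irrefl, dite_false]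
      linear_combination S i i * hcL
    · simp [W, h, h.not_gt, hS i j]
  have hdet : IsUnit x.det := by
    have hx : x = (algebraMap Q L).mapMatrix ((rename (fun p : Fin n × Fin n =>
        (.inl (p.1, .inl p.2) : ChartCoord n s)) : MvPolynomial _ K →ₐ[K] Q).toRingHom.mapMatrix
          (Matrix.mvPolynomialX (Fin n) (Fin n) K)) := by
      ext i k
      simp [x]
    rw [hx, ← RingHom.map_det, ← RingHom.map_det, isUnit_iff_ne_zero, Ne,
      FaithfulSMul.algebraMap_eq_zero_iff]
    refine fun h => Matrix.det_mvPolynomialX_ne_zero (Fin n) K ?_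
    refine rename_injective _ ?_ (h.trans (map_zero _).symm)
    rintro ⟨i, k⟩ ⟨i', k'⟩ h
    simpa using h
  let y : Matrix (Fin n) (Fin n) L := (x⁻¹ * W).transpose
  have hxy : ∀ i j, ∑ k, x i k * y j k = W i j := fun i j => by
    have : x * (x⁻¹ * W) = W := by rw [← mul_assoc, Matrix.mul_nonsing_inv _ hdet, one_mul]
    exact congrFun (congrFun this i) j
  let ψ : MvPolynomial (IsotropicCoord n s) K →ₐ[K] L := aeval fun
    | (i, .inl k) => x i k
    | (i, .inr (.inl k)) => y i k
    | (i, .inr (.inr l)) => z i l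
  refine ⟨ψ, ?_, fun q => ?_⟩
  · rw [isotropicIdeal, Ideal.span_le]
    rintro _ ⟨⟨⟨i, j⟩, hij⟩, rfl⟩
    have : S i j = algebraMap K L (M i j) - ∑ l, z i l * z j l := rfl
    simp only [SetLike.mem_coe, RingHom.mem_ker, isotropicForm, ψ, map_sub, map_add, map_sum,
      map_mul, aeval_X, ← algebraMap_eq, AlgHom.commutes, Finset.sum_add_distrib, hxy]
    simp only [mul_comm (y i _), hxy]
    linear_combination hW i j + this
  · have : ψ.comp (chartHom K n s) = IsScalarTower.toAlgHom K Q L := by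
      ext v
      obtain ⟨i, k | l⟩ | ⟨⟨i, j⟩, hij⟩ := v
      · simp [ψ, chartHom, x]; rfl
      · simp [ψ, chartHom, z]; rfl
      · simp only [AlgHom.comp_apply, ψ, chartHom, aeval_X, map_sum, map_mul, hxy,
          W, Matrix.of_apply, dif_pos (show j < i from hij)]
        rfl
    exact DFunLike.congr_fun this q

theorem chartHom_mapMatrix :
    (chartHom K n s).mapMatrix (.of fun i k => X (.inl (i, .inl k))) =
      isotropicMatrix K n s := by
  ext1 i k
  simp [chartHom, isotropicMatrix]

theorem exists_det_pow_mul_sub_mem {c : K} (hc : 2 * c = 1)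
    (M : Matrix (Fin n) (Fin n) K) (h : MvPolynomial (IsotropicCoord n s) K) :
    ∃ (N : ℕ) (q : MvPolynomial (ChartCoord n s) K),
      (isotropicMatrix K n s).det ^ N * h - chartHom K n s q ∈ isotropicIdeal s M := by
  set I := isotropicIdeal s M
  set D := (isotropicMatrix K n s).det
  let π := Ideal.Quotient.mkₐ K I
  let A : Subalgebra K (MvPolynomial (IsotropicCoord n s) K) :=
    (π.comp (chartHom K n s)).range.comap π
  have hA : ∀ h, h ∈ A ↔ ∃ q, h - chartHom K n s q ∈ I := fun h =>
    ⟨fun ⟨q, hq⟩ => ⟨q, Ideal.Quotient.eq.1 hq.symm⟩,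
      fun ⟨q, hq⟩ => ⟨q, (Ideal.Quotient.eq.2 hq).symm⟩⟩
  have hρ : ∀ q, chartHom K n s q ∈ A := fun q => (hA _).2 ⟨q, by simp⟩
  have hI : ∀ h ∈ I, h ∈ A := fun h hh => (hA _).2 ⟨0, by simpa using hh⟩
  have hx : ∀ i k, X (i, .inl k) ∈ A := fun i k => by
    simpa [chartHom] using hρ (X (.inl (i, .inl k)))
  have hz : ∀ i l, X (i, .inr (.inr l)) ∈ A := fun i k => by
    simpa [chartHom] using hρ (X (.inl (i, .inr k)))
  have hC : ∀ a, C a ∈ A := fun a => A.algebraMap_mem a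
  have hD : D ∈ A := by
    have := hρ (Matrix.det (.of fun i k => X (.inl (i, .inl k))))
    rwa [AlgHom.map_det, chartHom_mapMatrix] at this
  let V : Matrix (Fin n) (Fin n) (MvPolynomial (IsotropicCoord n s) K) :=
    isotropicMatrix K n s * .of fun k j => X (j, .inr (.inl k))
  have hVapp : ∀ i j, V i j = ∑ k, X (i, .inl k) * X (j, .inr (.inl k)) := fun i j => rfl
  have hVlt : ∀ i j, j < i → V i j ∈ A := fun i j hij => by
    simpa [chartHom, hVapp] using hρ (X (.inr ⟨(i, j), hij⟩))
  have hVadd : ∀ i j, i ≤ j → V i j + V j i ∈ A := fun i j hij => by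
    have h1 : isotropicForm s M i j ∈ A := hI _ (Ideal.subset_span ⟨⟨(i, j), hij⟩, rfl⟩)
    have h2 := sub_mem (add_mem h1 (hC (M i j)))
      (sum_mem (t := Finset.univ) fun l _ => mul_mem (hz i l) (hz j l))
    convert h2 using 1
    simp only [hVapp, isotropicForm, Finset.sum_add_distrib, mul_comm (X (j, Sum.inl _))]
    ring
  have hV : ∀ i j, V i j ∈ A := fun i j => by
    rcases lt_trichotomy i j with hij | rfl | hij
    · simpa using sub_mem (hVadd i j hij.le) (hVlt j i hij)
    · have := mul_mem (hC c) (hVadd i i le_rfl)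
      have hc' : (2 : MvPolynomial (IsotropicCoord n s) K) * C c = 1 := by
        rw [← map_ofNat C 2, ← map_mul, hc, map_one]
      convert this using 1
      linear_combination (-V i i) * hc'
    · exact hVlt i j hij
  have hadj : ∀ k i, (isotropicMatrix K n s).adjugate k i ∈ A := fun k i => by
    rw [← chartHom_mapMatrix, ← AlgHom.map_adjugate]
    exact hρ _
  have hy : ∀ j k, D * X (j, .inr (.inl k)) ∈ A := fun j k => by
    have h1 : (isotropicMatrix K n s).adjugate * V = D • .of fun k j => X (j, .inr (.inl k)) := by
      rw [← mul_assoc, Matrix.adjugate_mul, Matrix.smul_mul, one_mul]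
    have h2 := congrFun (congrFun h1 k) j
    rw [Matrix.smul_apply, Matrix.of_apply, smul_eq_mul, Matrix.mul_apply] at h2
    rw [← h2]
    exact sum_mem fun i _ => mul_mem (hadj k i) (hV i j)
  suffices ∃ N, D ^ N * h ∈ A by
    obtain ⟨N, hN⟩ := this
    exact ⟨N, (hA _).1 hN⟩
  induction h using MvPolynomial.induction_on with
  | C a => exact ⟨0, by simpa using hC a⟩
  | add p q hp hq =>
    obtain ⟨N, hN⟩ := hp
    obtain ⟨N', hN'⟩ := hq
    refine ⟨N + N', ?_⟩
    convert add_mem (mul_mem (pow_mem hD N') hN) (mul_mem (pow_mem hD N) hN') using 1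
    ring
  | mul_X p v hp =>
    obtain ⟨N, hN⟩ := hp
    refine ⟨N + 1, ?_⟩
    have hv : D * X v ∈ A := by
      obtain ⟨i, k | k | l⟩ := v
      · exact mul_mem hD (hx i k)
      · exact hy i k
      · exact mul_mem hD (hz i l)
    convert mul_mem hN hv using 1
    ring

theorem isPrime_isotropicIdeal [IsDomain K] {c : K} (hc : 2 * c = 1)
    {M : Matrix (Fin n) (Fin n) K} (hM : M.IsSymm) : (isotropicIdeal s M).IsPrime := by
  obtain ⟨ψ, hψ, hψρ⟩ := exists_chart_retraction (s := s) hc hM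
  have hker : isotropicIdeal s M = RingHom.ker ψ := by
    refine le_antisymm hψ fun h hh => ?_
    obtain ⟨N, q, hq⟩ := exists_det_pow_mul_sub_mem hc M h
    have h0 := hψ hq
    rw [RingHom.mem_ker, map_sub, map_mul, (RingHom.mem_ker).1 hh, mul_zero, zero_sub, hψρ,
      neg_eq_zero, FaithfulSMul.algebraMap_eq_zero_iff] at h0
    rw [h0, map_zero, sub_zero] at hq
    clear h0
    induction N with
    | zero => simpa using hq
    | succ N ih =>
      refine ih (mem_isotropicIdeal_of_mul_det_mem ?_)
      convert hq using 1
      ring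
  rw [hker]
  exact RingHom.ker_isPrime _

end Localization

/-- A criterion for an ideal `I` to be the contraction of a prime ideal. -/
theorem Ideal.isPrime_of_retraction {R S : Type*} [CommRing R] [CommRing S] {I : Ideal R}
    {J : Ideal S} [J.IsPrime] (θ : R →+* S) (ψ : S →+* R ⧸ I) (hθ : I ≤ J.comap θ)
    (hψ : J ≤ RingHom.ker ψ) (hψθ : ∀ r, ψ (θ r) = Ideal.Quotient.mk I r) : I.IsPrime := by
  have : I = J.comap θ := le_antisymm hθ fun r hr => by
    rw [← Ideal.Quotient.eq_zero_iff_mem, ← hψθ]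
    exact hψ hr
  rw [this]
  infer_instance

section Orthonormal

variable {K : Type*} [CommRing K] {n p : ℕ}

/-- The ideal of the fibre of `A ↦ AᵀA` over `M`. -/
noncomputable def gramIdeal (p : ℕ) (M : Matrix (Fin n) (Fin n) K) :
    Ideal (MvPolynomial (Fin p × Fin n) K) :=
  Ideal.span {f | ∃ i j : Fin n, i ≤ j ∧ f = (∑ k : Fin p, X (k, i) * X (k, j)) - C (M i j)}

theorem isPrime_gramIdeal [IsDomain K] {c ι : K} (hc : 2 * c = 1) (hι : ι * ι = -1)
    {M : Matrix (Fin n) (Fin n) K} (hM : M.IsSymm) (hp : 2 * n < p) : (gramIdeal p M).IsPrime := by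
  obtain ⟨s, rfl⟩ : ∃ s, p = n + (n + (s + 1)) := ⟨p - 2 * n - 1, by omega⟩
  let e : Fin n ⊕ Fin n ⊕ Fin (s + 1) ≃ Fin (n + (n + (s + 1))) :=
    (Equiv.sumCongr (Equiv.refl _) finSumFinEquiv).trans finSumFinEquiv
  let θ : MvPolynomial (Fin (n + (n + (s + 1))) × Fin n) K →ₐ[K]
      MvPolynomial (IsotropicCoord n s) K :=
    aeval fun v => match e.symm v.1 with
      | .inl a => X (v.2, .inl a) + C c * X (v.2, .inr (.inl a))
      | .inr (.inl a) => -C ι * (X (v.2, .inl a) - C c * X (v.2, .inr (.inl a)))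
      | .inr (.inr l) => X (v.2, .inr (.inr l))
  let ψ : MvPolynomial (IsotropicCoord n s) K →ₐ[K]
      MvPolynomial (Fin (n + (n + (s + 1))) × Fin n) K :=
    aeval fun
      | (i, .inl a) => C c * (X (e (.inl a), i) + C ι * X (e (.inr (.inl a)), i))
      | (i, .inr (.inl a)) => X (e (.inl a), i) - C ι * X (e (.inr (.inl a)), i)
      | (i, .inr (.inr l)) => X (e (.inr (.inr l)), i)
  have hc' : ∀ τ : Type, (2 : MvPolynomial τ K) * C c = 1 := fun τ => by
    rw [← map_ofNat C 2, ← map_mul, hc, map_one]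
  have hι' : ∀ τ : Type, (C ι : MvPolynomial τ K) * C ι = -1 := fun τ => by
    rw [← map_mul, hι, map_neg, map_one]
  have hsum : ∀ i j : Fin n, ∑ k, (X (k, i) * X (k, j) :
      MvPolynomial (Fin (n + (n + (s + 1))) × Fin n) K) =
      ∑ a, (X (e (.inl a), i) * X (e (.inl a), j) +
        X (e (.inr (.inl a)), i) * X (e (.inr (.inl a)), j)) +
      ∑ l, X (e (.inr (.inr l)), i) * X (e (.inr (.inr l)), j) := fun i j => by
    rw [← e.sum_comp, Fintype.sum_sum_type, Fintype.sum_sum_type, Finset.sum_add_distrib,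
      add_assoc]
  have hψθ : ψ.comp θ = AlgHom.id K _ := by
    ext1 v
    obtain ⟨k, i⟩ := v
    obtain ⟨a | a | l, rfl⟩ := e.surjective k
    · simp only [AlgHom.comp_apply, θ, aeval_X, Equiv.symm_apply_apply, ψ, map_add, map_mul,
        ← algebraMap_eq, AlgHom.commutes, AlgHom.id_apply]
      simp only [algebraMap_eq]
      linear_combination X (e (.inl a), i) * hc' _
    · simp only [AlgHom.comp_apply, θ, aeval_X, Equiv.symm_apply_apply, ψ, map_sub, map_neg,
        map_mul, ← algebraMap_eq, AlgHom.commutes, AlgHom.id_apply]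
      simp only [algebraMap_eq]
      linear_combination (-2 * C c * X (e (.inr (.inl a)), i)) * hι' _ +
        X (e (.inr (.inl a)), i) * hc' _
    · simp [θ, ψ]
  have hθ₁ : ∀ i a, θ (X (e (.inl a), i)) = X (i, .inl a) + C c * X (i, .inr (.inl a)) :=
    fun i a => by simp only [θ, aeval_X, Equiv.symm_apply_apply]
  have hθ₂ : ∀ i a, θ (X (e (.inr (.inl a)), i)) =
      -C ι * (X (i, .inl a) - C c * X (i, .inr (.inl a))) :=
    fun i a => by simp only [θ, aeval_X, Equiv.symm_apply_apply]
  have hθ₃ : ∀ i l, θ (X (e (.inr (.inr l)), i)) = X (i, .inr (.inr l)) :=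
    fun i l => by simp only [θ, aeval_X, Equiv.symm_apply_apply]
  have hθform : ∀ i j, θ (∑ k, X (k, i) * X (k, j) - C (M i j)) = isotropicForm s M i j := by
    intro i j
    have hC : θ (C (M i j)) = C (M i j) := θ.commutes _
    rw [hsum, map_sub, hC, isotropicForm]
    simp only [map_add, map_sum, map_mul, hθ₁, hθ₂, hθ₃]
    refine congrArg (· + _ - _) (Finset.sum_congr rfl fun a _ => ?_)
    linear_combination ((X (i, .inl a) - C c * X (i, .inr (.inl a))) *
      (X (j, .inl a) - C c * X (j, .inr (.inl a)))) * hι' _ +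
      (X (i, .inl a) * X (j, .inr (.inl a)) + X (i, .inr (.inl a)) * X (j, .inl a)) * hc' _
  have hψform : ∀ i j, ψ (isotropicForm s M i j) = ∑ k, X (k, i) * X (k, j) - C (M i j) :=
    fun i j => by rw [← hθform]; exact DFunLike.congr_fun hψθ _
  have := isPrime_isotropicIdeal (s := s) hc hM
  refine Ideal.isPrime_of_retraction (J := isotropicIdeal s M) θ.toRingHom
    ((Ideal.Quotient.mk _).comp ψ.toRingHom) ?_ ?_ fun r => ?_
  · rw [gramIdeal, Ideal.span_le]
    rintro _ ⟨i, j, hij, rfl⟩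
    exact (congrArg (· ∈ isotropicIdeal s M) (hθform i j)).mpr
      (Ideal.subset_span ⟨⟨(i, j), hij⟩, rfl⟩)
  · rw [isotropicIdeal, Ideal.span_le]
    rintro _ ⟨⟨⟨i, j⟩, hij⟩, rfl⟩
    refine Ideal.Quotient.eq_zero_iff_mem.2 ?_
    exact (congrArg (· ∈ gramIdeal _ M) (hψform i j)).mpr
      (Ideal.subset_span ⟨i, j, hij, rfl⟩)
  · exact congrArg _ (DFunLike.congr_fun hψθ r)

end Orthonormal

/-- For the dual pair `(O(p,q), Sp(2n,ℝ))` in the stable range `2n < min(p,q)`,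
the scheme-theoretic fiber of the moment map `ψ(A,B) = (AᵀA, BᵀB)` over any point
`(X,Y)` (with `X`, `Y` symmetric) is reduced and irreducible: the quotient of the
polynomial ring by the fiber ideal is an integral domain. -/
theorem momentFiberOSp_isDomain (p q n : ℕ) (hp : 0 < p) (hq : 0 < q) (hn : 0 < n)
    (h1 : 2 * n < p) (h2 : 2 * n < q)
    (Xm Ym : Matrix (Fin n) (Fin n) ℂ) (hX : Xm.IsSymm) (hY : Ym.IsSymm) :
    IsDomain (MvPolynomial ((Fin p × Fin n) ⊕ (Fin q × Fin n)) ℂ ⧸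
      momentFiberIdealOSp p q n Xm Ym) := by
  have hc : (2 : ℂ) * (1 / 2) = 1 := by norm_num
  have : (gramIdeal p Xm).IsPrime := isPrime_gramIdeal hc Complex.I_mul_I hX h1
  let K := MvPolynomial (Fin p × Fin n) ℂ ⧸ gramIdeal p Xm
  let Ym' : Matrix (Fin n) (Fin n) K := Ym.map (algebraMap ℂ K)
  have : (gramIdeal q Ym').IsPrime := by
    refine isPrime_gramIdeal (c := algebraMap ℂ K (1 / 2)) (ι := algebraMap ℂ K Complex.I)
      ?_ ?_ (hY.map _) h2
    · rw [← map_ofNat (algebraMap ℂ K) 2, ← map_mul, hc, map_one]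
    · rw [← map_mul, Complex.I_mul_I, map_neg, map_one]
  set I := momentFiberIdealOSp p q n Xm Ym
  let θ : MvPolynomial ((Fin p × Fin n) ⊕ (Fin q × Fin n)) ℂ →ₐ[ℂ]
      MvPolynomial (Fin q × Fin n) K :=
    aeval (Sum.elim (fun v => C (Ideal.Quotient.mk _ (X v))) X)
  let π := Ideal.Quotient.mkₐ ℂ I
  let ψ₀ : K →ₐ[ℂ] MvPolynomial ((Fin p × Fin n) ⊕ (Fin q × Fin n)) ℂ ⧸ I :=
    Ideal.Quotient.liftₐ _ (π.comp (rename Sum.inl)) (by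
      suffices gramIdeal p Xm ≤ RingHom.ker (π.comp (rename Sum.inl)) from fun a ha => this ha
      rw [gramIdeal, Ideal.span_le]
      rintro _ ⟨i, j, hij, rfl⟩
      refine Ideal.Quotient.eq_zero_iff_mem.2 (Ideal.subset_span (.inl ⟨i, j, hij, ?_⟩))
      simp)
  let ψ : MvPolynomial (Fin q × Fin n) K →+*
      MvPolynomial ((Fin p × Fin n) ⊕ (Fin q × Fin n)) ℂ ⧸ I :=
    eval₂Hom ψ₀.toRingHom fun v => π (X (.inr v))
  have hψC : ∀ a, ψ (C (algebraMap ℂ K a)) = π (C a) := fun a => by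
    rw [eval₂Hom_C]
    exact (ψ₀.commutes a).trans (π.commutes a).symm
  have hI : I.IsPrime := by
    refine Ideal.isPrime_of_retraction (J := gramIdeal q Ym') θ.toRingHom ψ ?_ ?_ fun r => ?_
    · refine Ideal.span_le.2 ?_
      rintro _ (⟨i, j, hij, rfl⟩ | ⟨i, j, hij, rfl⟩)
      · have h0 : Ideal.Quotient.mk (gramIdeal p Xm)
            (∑ k : Fin p, X (k, i) * X (k, j) - C (Xm i j)) = 0 :=
          Ideal.Quotient.eq_zero_iff_mem.2 (Ideal.subset_span ⟨i, j, hij, rfl⟩)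
        have h3 : θ (∑ k : Fin p, X (.inl (k, i)) * X (.inl (k, j)) - C (Xm i j)) =
            C (Ideal.Quotient.mk (gramIdeal p Xm)
              (∑ k : Fin p, X (k, i) * X (k, j) - C (Xm i j))) := by
          simp only [map_sub, map_sum, map_mul, θ, aeval_X, aeval_C, Sum.elim_inl]
          rfl
        rw [h0, map_zero] at h3
        exact (congrArg (· ∈ gramIdeal q Ym') h3).mpr (zero_mem _)
      · refine Ideal.subset_span ⟨i, j, hij, ?_⟩
        simp only [AlgHom.toRingHom_eq_coe, AlgHom.coe_toRingHom, map_sub, map_sum, map_mul, θ,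
          aeval_X, aeval_C, Sum.elim_inr]
        rfl
    · refine Ideal.span_le.2 ?_
      rintro _ ⟨i, j, hij, rfl⟩
      have h0 : π (∑ k : Fin q, X (.inr (k, i)) * X (.inr (k, j)) - C (Ym i j)) = 0 :=
        Ideal.Quotient.eq_zero_iff_mem.2 (Ideal.subset_span (.inr ⟨i, j, hij, rfl⟩))
      rw [SetLike.mem_coe, RingHom.mem_ker, ← h0, map_sub, map_sub]
      refine congrArg₂ _ ?_ (hψC _)
      simp [ψ]
    · induction r using MvPolynomial.induction_on with
      | C a =>
        refine Eq.trans (congrArg ψ ?_) (hψC a)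
        exact θ.commutes a
      | add p q hp hq => rw [map_add, map_add, hp, hq, map_add]
      | mul_X p v hp =>
        rw [map_mul, map_mul, hp, map_mul]
        congr 1
        obtain v | v := v
        · simp only [AlgHom.toRingHom_eq_coe, AlgHom.coe_toRingHom, θ, aeval_X,
            Sum.elim_inl, ψ, eval₂Hom_C]
          exact congrArg π (rename_X Sum.inl v)
        · simp [θ, ψ, π]
  infer_instance
end

section
/- Let p, q, n be positive integers with n ≤ p and n ≤ q, and let X, Y be complex alternating (skew-symmetric with zero diagonal) n×n matrices. In the polynomial ring over ℂ in variables a_{k,i} (1 ≤ k ≤ 2p, 1 ≤ i ≤ n) and b_{l,j} (1 ≤ l ≤ 2q, 1 ≤ j ≤ n), let I be the ideal generated by the polynomials ∑_{k=1}^p (a_{k,i} a_{k+p,j} − a_{k+p,i} a_{k,j}) − X_{i,j} for 1 ≤ i < j ≤ n, together with the polynomials ∑_{l=1}^q (b_{l,i} b_{l+q,j} − b_{l+q,i} b_{l,j}) − Y_{i,j} for 1 ≤ i < j ≤ n. Then the quotient of the polynomial ring by I is an integral domain. (That is, the scheme-theoretic fiber of the moment map ψ(A,B) = (AᵀJ_pA,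 BᵀJ_qB) over the point (X,Y) is reduced and irreducible.) -/
open Matrix MvPolynomial

/-- The index `k` (for `1 ≤ k ≤ p`) viewed inside `Fin (2*p)`. -/
def finLow (p : ℕ) (k : Fin p) : Fin (2 * p) := ⟨(k : ℕ), by omega⟩

/-- The index `k + p` (for `1 ≤ k ≤ p`) viewed inside `Fin (2*p)`. -/
def finHigh (p : ℕ) (k : Fin p) : Fin (2 * p) := ⟨(k : ℕ) + p, by omega⟩

/-- The ideal of the scheme-theoretic fiber of the moment map
`ψ(A,B) = (AᵀJ_pA, BᵀJ_qB)` over the point `(X,Y)`, in the polynomial ring of the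
matrix entries of `A ∈ M_{2p,n}(ℂ)` and `B ∈ M_{2q,n}(ℂ)`. -/
noncomputable def momentFiberIdealSpOst (p q n : ℕ)
    (Xm Ym : Matrix (Fin n) (Fin n) ℂ) :
    Ideal (MvPolynomial ((Fin (2 * p) × Fin n) ⊕ (Fin (2 * q) × Fin n)) ℂ) :=
  Ideal.span
    ({f | ∃ i j : Fin n, i < j ∧
        f = (∑ k : Fin p,
              (X (Sum.inl (finLow p k, i)) * X (Sum.inl (finHigh p k, j)) -
               X (Sum.inl (finHigh p k, i)) * X (Sum.inl (finLow p k, j)))) -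
            C (Xm i j)} ∪
     {f | ∃ i j : Fin n, i < j ∧
        f = (∑ l : Fin q,
              (X (Sum.inr (finLow q l, i)) * X (Sum.inr (finHigh q l, j)) -
               X (Sum.inr (finHigh q l, i)) * X (Sum.inr (finLow q l, j)))) -
            C (Ym i j)})


/-- The polynomials all of whose monomials have weight less than `d`. -/
noncomputable def weightLT {σ : Type*} (R : Type*) [CommRing R] (w : σ → ℕ) (d : ℕ) :
    Submodule R (MvPolynomial σ R) :=
  restrictSupport R {β | Finsupp.weight w β < d}

lemma weightLT_mono {σ R : Type*} [CommRing R] (w : σ → ℕ) {d e : ℕ} (h : d ≤ e) :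
    weightLT R w d ≤ weightLT R w e :=
  restrictSupport_mono R fun _ hβ => lt_of_lt_of_le hβ h

lemma mul_mem_weightLT {σ R : Type*} [CommRing R] {w : σ → ℕ} {d e : ℕ}
    {f g : MvPolynomial σ R} (hf : f ∈ weightLT R w (d + 1)) (hg : g ∈ weightLT R w e) :
    f * g ∈ weightLT R w (d + e) := by
  have h := Submodule.mul_mem_mul hf hg
  rw [weightLT, weightLT, ← restrictSupport_add] at h
  refine restrictSupport_mono R ?_ h
  rintro _ ⟨a, ha, b, hb, rfl⟩
  simp only [Set.mem_ofPred_eq, map_add] at *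
  omega

lemma monomial_mem_weightLT {σ R : Type*} [CommRing R] {w : σ → ℕ} {d : ℕ} {β : σ →₀ ℕ} {r : R}
    (h : Finsupp.weight w β < d) : monomial β r ∈ weightLT R w d :=
  (monomial_mem_restrictSupport R).2 (Or.inl h)

lemma exists_mem_weightLT {σ R : Type*} [CommRing R] (w : σ → ℕ) (g : MvPolynomial σ R) :
    ∃ d, g ∈ weightLT R w d := by
  refine ⟨g.support.sup (Finsupp.weight w) + 1, (mem_restrictSupport_iff R).2 fun β hβ => ?_⟩
  exact Nat.lt_succ_of_le (Finset.le_sup (f := Finsupp.weight w) hβ)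

lemma weightLT_zero {σ R : Type*} [CommRing R] (w : σ → ℕ) : weightLT R w 0 = ⊥ := by
  refine (Submodule.eq_bot_iff _).2 fun g hg => ?_
  rw [← support_eq_empty, ← Finset.coe_eq_empty, Set.eq_empty_iff_forall_notMem]
  exact fun β hβ => Nat.not_lt_zero _ ((mem_restrictSupport_iff R).1 hg hβ)

section Unitriangular

variable {σ R : Type*} [CommRing R] {w : σ → ℕ}
  {T : MvPolynomial σ R →ₗ[R] MvPolynomial σ R}

lemma sub_mem_weightLT_of_unitriangular
    (hT : ∀ β, T (monomial β 1) - monomial β 1 ∈ weightLT R w (Finsupp.weight w β))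
    {d : ℕ} {g : MvPolynomial σ R} (hg : g ∈ weightLT R w (d + 1)) :
    T g - g ∈ weightLT R w d := by
  suffices h : weightLT R w (d + 1) ≤ (weightLT R w d).comap (T - LinearMap.id) from h hg
  rw [weightLT, restrictSupport_eq_span, Submodule.span_le]
  rintro _ ⟨β, hβ, rfl⟩
  exact weightLT_mono w (Nat.le_of_lt_succ hβ) (hT β)

lemma bijective_of_unitriangular
    (hT : ∀ β, T (monomial β 1) - monomial β 1 ∈ weightLT R w (Finsupp.weight w β)) :
    Function.Bijective T := by
  constructor
  · refine (injective_iff_map_eq_zero T).2 fun g hg => ?_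
    obtain ⟨d, hd⟩ := exists_mem_weightLT w g
    induction d with
    | zero => simpa [weightLT_zero] using hd
    | succ d ih =>
      have := sub_mem_weightLT_of_unitriangular hT hd
      rw [hg, zero_sub, neg_mem_iff] at this
      exact ih this
  · intro g
    obtain ⟨d, hd⟩ := exists_mem_weightLT w g
    induction d generalizing g with
    | zero => exact ⟨0, by simpa [weightLT_zero, eq_comm] using hd⟩
    | succ d ih =>
      obtain ⟨h, hh⟩ := ih _ (sub_mem_weightLT_of_unitriangular hT hd)
      exact ⟨g - h, by rw [map_sub, hh]; abel⟩

end Unitriangular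

section CoprimeLeadingTerms

variable {σ ι R : Type*} [CommRing R] (f : ι → MvPolynomial σ R) (u v : ι → σ)

/-- The exponent of `X (u i) * X (v i)`. -/
noncomputable def pairExponent (i : ι) : σ →₀ ℕ :=
  Finsupp.single (u i) 1 + Finsupp.single (v i) 1

/-- The exponent of the largest power of `X (u i) * X (v i)` dividing the monomial `β`. -/
def pairMultiplicity (β : σ →₀ ℕ) (i : ι) : ℕ := min (β (u i)) (β (v i))

variable {u v}

lemma pairMultiplicity_add [DecidableEq ι] (huv : Function.Injective (Sum.elim u v))
    (β : σ →₀ ℕ) (i j : ι) :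
    pairMultiplicity u v (β + pairExponent u v i) j =
      pairMultiplicity u v β j + if j = i then 1 else 0 := by
  classical
  have h₁ (a b) : u a = u b ↔ a = b :=
    ⟨fun h => Sum.inl_injective (huv (a₁ := Sum.inl a) (a₂ := Sum.inl b) h), congrArg u⟩
  have h₂ (a b) : v a = v b ↔ a = b :=
    ⟨fun h => Sum.inr_injective (huv (a₁ := Sum.inr a) (a₂ := Sum.inr b) h), congrArg v⟩
  have h₃ (a b) : u a ≠ v b :=
    fun h => Sum.inl_ne_inr (huv (a₁ := Sum.inl a) (a₂ := Sum.inr b) h)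
  simp only [pairMultiplicity, pairExponent, Finsupp.add_apply, Finsupp.single_apply, h₁, h₂, h₃,
    (h₃ _ _).symm, if_false, zero_add, add_zero, eq_comm (a := j)]
  split_ifs <;> omega

lemma pairExponent_le (huv : Function.Injective (Sum.elim u v)) {β : σ →₀ ℕ} {i : ι}
    (h : pairMultiplicity u v β i ≠ 0) : pairExponent u v i ≤ β := by
  classical
  have h₃ : u i ≠ v i :=
    fun h => Sum.inl_ne_inr (huv (a₁ := Sum.inl i) (a₂ := Sum.inr i) h)
  intro s
  simp only [pairMultiplicity, pairExponent, Finsupp.add_apply, Finsupp.single_apply] at h ⊢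
  split_ifs with h₁ h₂ h₂
  · exact absurd (h₁.trans h₂.symm) h₃
  · subst h₁; omega
  · subst h₂; omega
  · omega

lemma pairExponent_induction (huv : Function.Injective (Sum.elim u v)) {P : (σ →₀ ℕ) → Prop}
    (base : ∀ β, (∀ i, pairMultiplicity u v β i = 0) → P β)
    (step : ∀ β i, P β → P (β + pairExponent u v i)) (β : σ →₀ ℕ) : P β := by
  induction h : Finsupp.degree β using Nat.strong_induction_on generalizing β with
  | _ d ih =>
    by_cases h₀ : ∀ i, pairMultiplicity u v β i = 0
    · exact base β h₀
    · push Not at h₀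
      obtain ⟨i, hi⟩ := h₀
      obtain ⟨γ, rfl⟩ := exists_add_of_le (pairExponent_le huv hi)
      rw [add_comm]
      refine step γ i (ih _ ?_ γ rfl)
      rw [← h, map_add, pairExponent, map_add, Finsupp.degree_single, Finsupp.degree_single]
      omega

variable (u v) [Fintype ι]

/-- The monomial `β` with every factor `X (u i) * X (v i)` replaced by `f i`. -/
noncomputable def replacePairs (β : σ →₀ ℕ) : MvPolynomial σ R :=
  (∏ i, f i ^ pairMultiplicity u v β i) *
    monomial (β - ∑ i, pairMultiplicity u v β i • pairExponent u v i) 1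

variable {u v}

lemma replacePairs_of_forall_eq_zero {β : σ →₀ ℕ} (h : ∀ i, pairMultiplicity u v β i = 0) :
    replacePairs f u v β = monomial β 1 := by
  simp [replacePairs, h]

lemma replacePairs_add (huv : Function.Injective (Sum.elim u v)) (β : σ →₀ ℕ) (i : ι) :
    replacePairs f u v (β + pairExponent u v i) = f i * replacePairs f u v β := by
  classical
  simp only [replacePairs, pairMultiplicity_add huv, add_smul, Finset.sum_add_distrib, pow_add,
    Finset.prod_mul_distrib, ite_smul, one_smul, zero_smul, Finset.sum_ite_eq', pow_ite, pow_one,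
    pow_zero, Finset.prod_ite_eq', Finset.mem_univ, if_true, add_tsub_add_eq_tsub_right]
  ring

lemma replacePairs_add_single (huv : Function.Injective (Sum.elim u v)) {x : σ}
    (hx : x ∉ Set.range (Sum.elim u v)) (β : σ →₀ ℕ) :
    replacePairs f u v (β + Finsupp.single x 1) = X x * replacePairs f u v β := by
  induction β using pairExponent_induction huv with
  | base β hβ =>
    rw [replacePairs_of_forall_eq_zero f hβ, replacePairs_of_forall_eq_zero, X, monomial_mul,
      one_mul, add_comm]
    intro i
    have h₁ : x ≠ u i := fun h => hx ⟨Sum.inl i, h.symm⟩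
    have h₂ : x ≠ v i := fun h => hx ⟨Sum.inr i, h.symm⟩
    simpa [pairMultiplicity, Finsupp.single_apply, h₁, h₂] using hβ i
  | step β i ih =>
    rw [add_right_comm, replacePairs_add f huv, replacePairs_add f huv, ih]
    ring

lemma replacePairs_sub_mem (huv : Function.Injective (Sum.elim u v)) (w : σ → ℕ)
    (hf : ∀ i, f i - X (u i) * X (v i) ∈ weightLT R w (w (u i) + w (v i))) (β : σ →₀ ℕ) :
    replacePairs f u v β - monomial β 1 ∈ weightLT R w (Finsupp.weight w β) := by
  induction β using pairExponent_induction huv with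
  | base β hβ => simp [replacePairs_of_forall_eq_zero f hβ]
  | step β i ih =>
    have hw : Finsupp.weight w (pairExponent u v i) = w (u i) + w (v i) := by
      simp [pairExponent, Finsupp.weight_single]
    have hm : (X (u i) * X (v i) : MvPolynomial σ R) = monomial (pairExponent u v i) 1 := by
      rw [X, X, monomial_mul, one_mul, pairExponent]
    have hfi : f i ∈ weightLT R w (w (u i) + w (v i) + 1) := by
      rw [← sub_add_cancel (f i) (X (u i) * X (v i))]
      refine add_mem (weightLT_mono w (Nat.le_succ _) (hf i)) ?_
      rw [hm]
      exact monomial_mem_weightLT (by rw [hw]; exact Nat.lt_succ_self _)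
    have key : replacePairs f u v (β + pairExponent u v i) -
        monomial (β + pairExponent u v i) 1 =
          f i * (replacePairs f u v β - monomial β 1) +
            monomial β 1 * (f i - X (u i) * X (v i)) := by
      rw [replacePairs_add f huv, hm, mul_sub, mul_sub, monomial_mul, one_mul]
      ring
    rw [key, map_add, hw]
    refine add_mem ?_ (mul_mem_weightLT (monomial_mem_weightLT (Nat.lt_succ_self _)) (hf i))
    rw [add_comm (Finsupp.weight w β)]
    exact mul_mem_weightLT hfi ih

/-- If the top-weight parts of the `f i` are products `X (u i) * X (v i)` of pairwise distinct
variables, then any further variable is a nonzerodivisor modulo the ideal generated by the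
`f i`. -/
theorem mem_span_range_of_X_mul_mem (huv : Function.Injective (Sum.elim u v)) (w : σ → ℕ)
    (hf : ∀ i, f i - X (u i) * X (v i) ∈ weightLT R w (w (u i) + w (v i)))
    {x : σ} (hx : x ∉ Set.range (Sum.elim u v)) {g : MvPolynomial σ R}
    (hg : X x * g ∈ Ideal.span (Set.range f)) : g ∈ Ideal.span (Set.range f) := by
  classical
  let T : MvPolynomial σ R →ₗ[R] MvPolynomial σ R :=
    (basisMonomials σ R).constr R (replacePairs f u v)
  have hT (β) : T (monomial β 1) = replacePairs f u v β := by
    simpa using (basisMonomials σ R).constr_basis R (replacePairs f u v) β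
  have hTbij : Function.Bijective T :=
    bijective_of_unitriangular fun β => by
      rw [hT]; exact replacePairs_sub_mem f huv w hf β
  have hTf (i) (h) : T (h * monomial (pairExponent u v i) 1) = T h * f i := by
    suffices T ∘ₗ LinearMap.mulRight R (monomial (pairExponent u v i) 1) =
        LinearMap.mulRight R (f i) ∘ₗ T from LinearMap.congr_fun this h
    refine (basisMonomials σ R).ext fun β => ?_
    simp only [coe_basisMonomials, LinearMap.comp_apply, LinearMap.mulRight_apply, monomial_mul,
      one_mul, hT, replacePairs_add f huv, mul_comm]
  have hTx (h) : T (X x * h) = X x * T h := by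
    suffices T ∘ₗ LinearMap.mulLeft R (X x) = LinearMap.mulLeft R (X x) ∘ₗ T from
      LinearMap.congr_fun this h
    refine (basisMonomials σ R).ext fun β => ?_
    simp only [coe_basisMonomials, LinearMap.comp_apply, LinearMap.mulLeft_apply, hT,
      ← replacePairs_add_single f huv hx]
    rw [X, monomial_mul, one_mul, hT, add_comm]
  obtain ⟨h, rfl⟩ := hTbij.2 g
  rw [← hTx] at hg
  obtain ⟨c, hc⟩ := Ideal.mem_span_range_iff_exists_fun.1 hg
  choose d hd using fun i => hTbij.2 (c i)
  have hJ : X x * h ∈ Ideal.span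
      ((fun s => monomial s (1 : R)) '' Set.range (pairExponent u v)) := by
    rw [← Set.range_comp]
    refine Ideal.mem_span_range_iff_exists_fun.2 ⟨d, hTbij.1 ?_⟩
    simp only [← hc, map_sum, Function.comp_apply, hTf, hd]
  have hJ' : h ∈ Ideal.span
      ((fun s => monomial s (1 : R)) '' Set.range (pairExponent u v)) := by
    rw [mem_ideal_span_monomial_image] at hJ ⊢
    intro β hβ
    obtain ⟨_, ⟨i, rfl⟩, hi⟩ := hJ (Finsupp.single x 1 + β) (by
      rwa [mem_support_iff, coeff_X_mul, ← mem_support_iff])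
    refine ⟨_, ⟨i, rfl⟩, pairExponent_le huv ?_⟩
    have h₁ : x ≠ u i := fun h => hx ⟨Sum.inl i, h.symm⟩
    have h₂ : x ≠ v i := fun h => hx ⟨Sum.inr i, h.symm⟩
    have hu := hi (u i)
    have hv := hi (v i)
    simp only [pairExponent, Finsupp.add_apply, Finsupp.single_apply, h₁, h₂, if_true, if_false]
      at hu hv
    rw [pairMultiplicity]
    omega
  rw [← Set.range_comp] at hJ'
  obtain ⟨c, rfl⟩ := Ideal.mem_span_range_iff_exists_fun.1 hJ'
  refine Ideal.mem_span_range_iff_exists_fun.2 ⟨fun i => T (c i), ?_⟩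
  simp only [map_sum, Function.comp_apply, hTf]

end CoprimeLeadingTerms

section SymplecticForm

variable {p : ℕ} {T : Type*} [CommRing T]

/-- The standard symplectic form on `T ^ (2 * p)`. -/
def sympForm (u v : Fin p ⊕ Fin p → T) : T :=
  ∑ k, (u (Sum.inl k) * v (Sum.inr k) - u (Sum.inr k) * v (Sum.inl k))

lemma map_sympForm {T' : Type*} [CommRing T'] (φ : T →+* T') (u v : Fin p ⊕ Fin p → T) :
    φ (sympForm u v) = sympForm (fun k => φ (u k)) (fun k => φ (v k)) := by
  simp [sympForm]

lemma sympForm_add_smul (u v a : Fin p ⊕ Fin p → T) (s t : T) :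
    sympForm (fun k => u k + s * a k) (fun k => v k + t * a k) =
      sympForm u v + s * sympForm a v - t * sympForm a u := by
  simp only [sympForm, Finset.mul_sum, ← Finset.sum_add_distrib, ← Finset.sum_sub_distrib]
  exact Finset.sum_congr rfl fun k _ => by ring

lemma sympForm_add_smul_right (u a : Fin p ⊕ Fin p → T) (s : T) :
    sympForm a (fun k => u k + s * a k) = sympForm a u := by
  simp only [sympForm]
  exact Finset.sum_congr rfl fun k _ => by ring

/-- Forget the first hyperbolic pair of coordinates. -/
def sympTail (u : Fin (p + 1) ⊕ Fin (p + 1) → T) (k : Fin p ⊕ Fin p) : T :=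
  u (Sum.map Fin.succ Fin.succ k)

lemma sympForm_succ (u v : Fin (p + 1) ⊕ Fin (p + 1) → T) :
    sympForm u v = u (Sum.inl 0) * v (Sum.inr 0) - u (Sum.inr 0) * v (Sum.inl 0) +
      sympForm (sympTail u) (sympTail v) := by
  simp [sympForm, sympTail, Fin.sum_univ_succ, add_sub_add_comm]

/-- If `y` is the inverse of `a (Sum.inr 0)`, then this is the vector `v` whose symplectic
product with `a` is `c`, with `v (Sum.inr 0) = a (Sum.inr 0) * s` and with
`sympTail v - s • sympTail a = w`. -/
def sympExtend (a : Fin (p + 1) ⊕ Fin (p + 1) → T) (y s : T) (w : Fin p ⊕ Fin p → T) (c : T) :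
    Fin (p + 1) ⊕ Fin (p + 1) → T :=
  Sum.elim
    (Fin.cons (a (Sum.inl 0) * s + (sympForm (sympTail a) w - c) * y)
      fun k => w (Sum.inl k) + s * sympTail a (Sum.inl k))
    (Fin.cons (a (Sum.inr 0) * s) fun k => w (Sum.inr k) + s * sympTail a (Sum.inr k))

variable {a : Fin (p + 1) ⊕ Fin (p + 1) → T} {y : T}

lemma sympTail_sympExtend (s : T) (w : Fin p ⊕ Fin p → T) (c : T) :
    sympTail (sympExtend a y s w c) = fun k => w k + s * sympTail a k := by
  ext (k | k) <;> simp [sympTail, sympExtend]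

lemma sympTail_map {T' : Type*} [CommRing T'] (φ : T →+* T') (u : Fin (p + 1) ⊕ Fin (p + 1) → T) :
    sympTail (fun k => φ (u k)) = fun k => φ (sympTail u k) := rfl

lemma map_sympExtend {T' : Type*} [CommRing T'] (φ : T →+* T') (s : T) (w : Fin p ⊕ Fin p → T)
    (c : T) (k : Fin (p + 1) ⊕ Fin (p + 1)) :
    φ (sympExtend a y s w c k) =
      sympExtend (fun k => φ (a k)) (φ y) (φ s) (fun k => φ (w k)) (φ c) k := by
  rcases k with k | k <;> refine Fin.cases ?_ (fun k => ?_) k <;>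
    simp [sympExtend, map_sympForm, sympTail, sympTail_map]

lemma sympForm_sympExtend_right (hy : a (Sum.inr 0) * y = 1) (s : T) (w : Fin p ⊕ Fin p → T)
    (c : T) : sympForm a (sympExtend a y s w c) = c := by
  rw [sympForm_succ, sympTail_sympExtend, sympForm_add_smul_right]
  simp only [sympExtend, Sum.elim_inl, Sum.elim_inr, Fin.cons_zero]
  linear_combination (c - sympForm (sympTail a) w) * hy

lemma sympForm_sympExtend (hy : a (Sum.inr 0) * y = 1) (s t : T) (w z : Fin p ⊕ Fin p → T)
    (c d : T) : sympForm (sympExtend a y s w c) (sympExtend a y t z d) =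
      sympForm w z - t * c + s * d := by
  rw [sympForm_succ, sympTail_sympExtend, sympTail_sympExtend, sympForm_add_smul]
  simp only [sympExtend, Sum.elim_inl, Sum.elim_inr, Fin.cons_zero]
  linear_combination (t * (sympForm (sympTail a) w - c) - s * (sympForm (sympTail a) z - d)) * hy

lemma sympExtend_self (hy : a (Sum.inr 0) * y = 1) (v : Fin (p + 1) ⊕ Fin (p + 1) → T) :
    sympExtend a y (v (Sum.inr 0) * y)
      (fun k => sympTail v k + -(v (Sum.inr 0) * y) * sympTail a k) (sympForm a v) = v := by
  ext (k | k) <;> refine Fin.cases ?_ (fun k => ?_) k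
  · simp only [sympExtend, sympForm_add_smul_right, sympForm_succ a v, Sum.elim_inl,
      Fin.cons_zero]
    linear_combination v (Sum.inl 0) * hy
  · simp [sympExtend, sympTail]
  · simp only [sympExtend, Sum.elim_inr, Fin.cons_zero]
    linear_combination v (Sum.inr 0) * hy
  · simp [sympExtend, sympTail]

end SymplecticForm

section SymplecticFiber

variable {p n : ℕ} {D : Type*} [CommRing D]

/-- The equation prescribing the symplectic product of the columns `ij.1 < ij.2` of the generic
`2 * p` by `n` matrix. -/
noncomputable def sympEquation (p : ℕ) (M : Fin n → Fin n → D)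
    (ij : {ij : Fin n × Fin n // ij.1 < ij.2}) : MvPolynomial ((Fin p ⊕ Fin p) × Fin n) D :=
  sympForm (fun k => X (k, ij.1.1)) (fun k => X (k, ij.1.2)) - C (M ij.1.1 ij.1.2)

/-- The coordinate ring of the scheme of `n`-tuples of vectors in a `2 * p`-dimensional symplectic
space with prescribed symplectic products. -/
abbrev SympFiber (p : ℕ) (M : Fin n → Fin n → D) : Type _ :=
  MvPolynomial ((Fin p ⊕ Fin p) × Fin n) D ⧸ Ideal.span (Set.range (sympEquation p M))

namespace SympFiber

/-- The coordinates of the universal tuple of vectors. -/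
noncomputable def coord (M : Fin n → Fin n → D) (i : Fin n) (k : Fin p ⊕ Fin p) :
    SympFiber p M :=
  Ideal.Quotient.mk _ (X (k, i))

lemma sympForm_coord (M : Fin n → Fin n → D) {i j : Fin n} (h : i < j) :
    sympForm (coord (p := p) M i) (coord M j) = algebraMap D (SympFiber p M) (M i j) := by
  have : Ideal.Quotient.mk (Ideal.span (Set.range (sympEquation p M)))
      (sympEquation p M ⟨(i, j), h⟩) = 0 :=
    Ideal.Quotient.eq_zero_iff_mem.2 (Ideal.subset_span ⟨_, rfl⟩)
  rwa [sympEquation, map_sub, map_sympForm, sub_eq_zero] at this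

variable {T : Type*} [CommRing T]

/-- The universal property of `SympFiber`. -/
noncomputable def lift (M : Fin n → Fin n → D) (φ : D →+* T) (A : Fin n → Fin p ⊕ Fin p → T)
    (hA : ∀ i j, i < j → sympForm (A i) (A j) = φ (M i j)) : SympFiber p M →+* T :=
  Ideal.Quotient.lift _ (eval₂Hom φ fun ki => A ki.2 ki.1) fun f hf => by
    suffices Ideal.span (Set.range (sympEquation p M)) ≤
      RingHom.ker (eval₂Hom φ fun ki => A ki.2 ki.1) from this hf
    rw [Ideal.span_le]
    rintro _ ⟨⟨⟨i, j⟩, h⟩, rfl⟩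
    rw [SetLike.mem_coe, RingHom.mem_ker, sympEquation, map_sub, map_sympForm, sub_eq_zero]
    simpa only [eval₂Hom_X', eval₂Hom_C] using hA i j h

variable {M : Fin n → Fin n → D} {φ : D →+* T} {A : Fin n → Fin p ⊕ Fin p → T}
  (hA : ∀ i j, i < j → sympForm (A i) (A j) = φ (M i j))

@[simp]
lemma lift_coord (i : Fin n) (k : Fin p ⊕ Fin p) : lift M φ A hA (coord M i k) = A i k :=
  eval₂Hom_X' _ _ _

@[simp]
lemma lift_algebraMap (d : D) : lift M φ A hA (algebraMap D _ d) = φ d :=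
  eval₂Hom_C _ _ _

lemma ringHom_ext {φ ψ : SympFiber p M →+* T}
    (h : ∀ d, φ (algebraMap D _ d) = ψ (algebraMap D _ d))
    (h' : ∀ i k, φ (coord M i k) = ψ (coord M i k)) : φ = ψ :=
  Ideal.Quotient.ringHom_ext (MvPolynomial.ringHom_ext h fun ki => h' ki.2 ki.1)

/-- The weights for which the leading term of `sympEquation p M ⟨(i, j), h⟩` is the product of the
variables at positions `(Sum.inl (j - i - 1), i)` and `(Sum.inr (j - i - 1), j)`. -/
def sympWeight (p n : ℕ) : (Fin p ⊕ Fin p) × Fin n → ℕ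
  | (Sum.inl k, i) => p * p + 2 * (p * n) - ((k + 1) * (k + 1) + 2 * ((k + 1) * i))
  | (Sum.inr k, j) => 2 * ((k + 1) * j)

lemma sympWeight_inl_add (k : Fin p) (i j : Fin n) :
    (sympWeight p n (Sum.inl k, i) + sympWeight p n (Sum.inr k, j) : ℤ) =
      p * p + 2 * (p * n) + (j - i) ^ 2 - (k + 1 + i - j) ^ 2 := by
  have hk : (k : ℕ) + 1 ≤ p := k.2
  have h₁ : ((k : ℕ) + 1) * (k + 1) ≤ p * p := Nat.mul_le_mul hk hk
  have h₂ : ((k : ℕ) + 1) * i ≤ p * n := Nat.mul_le_mul hk i.2.le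
  simp only [sympWeight]
  rw [Nat.cast_sub (by omega)]
  push_cast
  ring

lemma X_mul_X_mem_weightLT {σ : Type*} {w : σ → ℕ} {d : ℕ} {a b : σ} (h : w a + w b < d) :
    (X a * X b : MvPolynomial σ D) ∈ weightLT D w d := by
  rw [X, X, monomial_mul]
  exact monomial_mem_weightLT (by simpa [Finsupp.weight_single] using h)

/-- The row containing the leading term of an equation. -/
def leadingRow (h : n ≤ p) (ij : {ij : Fin n × Fin n // ij.1 < ij.2}) : Fin p :=
  ⟨ij.1.2 - ij.1.1 - 1, by omega⟩

lemma sympEquation_sub_mem (M : Fin n → Fin n → D) (h : n ≤ p)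
    (ij : {ij : Fin n × Fin n // ij.1 < ij.2}) :
    sympEquation p M ij -
        X (Sum.inl (leadingRow h ij), ij.1.1) * X (Sum.inr (leadingRow h ij), ij.1.2) ∈
      weightLT D (sympWeight p n) (sympWeight p n (Sum.inl (leadingRow h ij), ij.1.1) +
        sympWeight p n (Sum.inr (leadingRow h ij), ij.1.2)) := by
  classical
  obtain ⟨⟨i, j⟩, hij⟩ := ij
  set r := leadingRow h ⟨(i, j), hij⟩ with hr
  have hij' : (i : ℕ) < j := hij
  have hrv : ((r : ℕ) : ℤ) = j - i - 1 := by
    simp only [hr, leadingRow]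
    omega
  have hlead := sympWeight_inl_add r i j
  rw [hrv, show (j - i - 1 + 1 + i - j : ℤ) = 0 by ring] at hlead
  have hpn : (0 : ℤ) ≤ p * p + 2 * (p * n) := by positivity
  have hji : (0 : ℤ) < (j - i) ^ 2 := by
    have : (i : ℤ) < j := by exact_mod_cast hij'
    exact pow_pos (by linarith) 2
  have key : sympEquation p M ⟨(i, j), hij⟩ - X (Sum.inl r, i) * X (Sum.inr r, j) =
      ∑ k : Fin p, ((X (Sum.inl k, i) * X (Sum.inr k, j) -
        if k = r then X (Sum.inl r, i) * X (Sum.inr r, j) else 0) -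
          X (Sum.inr k, i) * X (Sum.inl k, j)) - C (M i j) := by
    simp only [sympEquation, sympForm, Finset.sum_sub_distrib, Finset.sum_ite_eq',
      Finset.mem_univ, if_true]
    ring
  rw [key]
  refine sub_mem (sum_mem fun k _ => sub_mem ?_ ?_) ?_
  · split_ifs with hk
    · simp [hk]
    · rw [sub_zero]
      refine X_mul_X_mem_weightLT ?_
      have hk' : (k + 1 + i - j : ℤ) ≠ 0 := by
        intro h0
        exact hk (Fin.ext (by omega))
      have := sympWeight_inl_add k i j
      have := pow_pos (abs_pos.2 hk') 2
      rw [sq_abs] at this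
      zify
      linarith
  · refine X_mul_X_mem_weightLT ?_
    have := sympWeight_inl_add k j i
    have h₁ : ((j : ℤ) - i) ^ 2 < (k + 1 + j - i) ^ 2 := by
      have : (i : ℤ) < j := by exact_mod_cast hij'
      gcongr
      linarith
    have h₂ : ((i : ℤ) - j) ^ 2 = (j - i) ^ 2 := by ring
    zify
    linarith
  · refine monomial_mem_weightLT ?_
    rw [map_zero]
    zify
    linarith

lemma coord_zero_mem_nonZeroDivisors (h : n + 1 ≤ p + 1) (M : Fin (n + 1) → Fin (n + 1) → D) :
    coord (p := p + 1) M 0 (Sum.inr 0) ∈ nonZeroDivisors (SympFiber (p + 1) M) := by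
  rw [mem_nonZeroDivisors_iff_left]
  intro z hz
  obtain ⟨g, rfl⟩ := Ideal.Quotient.mk_surjective z
  rw [coord, ← map_mul, Ideal.Quotient.eq_zero_iff_mem] at hz
  rw [Ideal.Quotient.eq_zero_iff_mem]
  refine mem_span_range_of_X_mul_mem _ ?_ _ (sympEquation_sub_mem M h) ?_ hz
  · rintro (⟨⟨i, j⟩, hij⟩ | ⟨⟨i, j⟩, hij⟩) (⟨⟨i', j'⟩, hij'⟩ | ⟨⟨i', j'⟩, hij'⟩) <;>
      simp only [Sum.elim_inl, Sum.elim_inr, leadingRow, Prod.mk.injEq, Sum.inl.injEq,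
        Sum.inr.injEq, reduceCtorEq, false_and, IsEmpty.forall_iff, Subtype.mk.injEq, Fin.ext_iff,
        Fin.lt_def] at hij hij' ⊢ <;> omega
  · rintro ⟨(⟨⟨i, j⟩, hij⟩ | ⟨⟨i, j⟩, hij⟩), he⟩
    · simp at he
    · simp only [Sum.elim_inr, Prod.mk.injEq] at he
      exact absurd hij (by simp [he.2])

universe u

theorem isDomain (h : n ≤ p) {D : Type u} [CommRing D] [IsDomain D] (M : Fin n → Fin n → D) :
    IsDomain (SympFiber p M) := by
  induction n generalizing p D with
  | zero =>
    have : Ideal.span (Set.range (sympEquation p M)) = ⊥ := by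
      rw [Set.range_eq_empty_iff.2 ⟨fun ij => ij.1.1.elim0⟩, Ideal.span_empty]
    have : (Ideal.span (Set.range (sympEquation p M))).IsPrime := this ▸ Ideal.isPrime_bot
    exact Ideal.Quotient.isDomain _
  | succ n ih =>
    obtain ⟨p, rfl⟩ : ∃ p', p = p' + 1 := ⟨p - 1, by omega⟩
    let P := MvPolynomial ((Fin (p + 1) ⊕ Fin (p + 1)) ⊕ Fin n) D
    let x : P := X (Sum.inl (Sum.inr 0))
    let D' := Localization.Away x
    have hD' : IsDomain D' := IsLocalization.isDomain_localization
      (powers_le_nonZeroDivisors_of_noZeroDivisors (X_ne_zero _))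
    let a (k) : D' := algebraMap P D' (X (Sum.inl k))
    let s (j) : D' := algebraMap P D' (X (Sum.inr j))
    let y : D' := IsLocalization.Away.invSelf x
    have hy : a (Sum.inr 0) * y = 1 := IsLocalization.Away.mul_invSelf x
    let c (j : Fin n) : D' := algebraMap P D' (C (M 0 j.succ))
    let M' (i j : Fin n) : D' :=
      algebraMap P D' (C (M i.succ j.succ)) + s j * c i - s i * c j
    have hE : IsDomain (SympFiber p M') := ih (by omega) M'
    let ι := algebraMap D' (SympFiber p M')
    have hιy : ι (a (Sum.inr 0)) * ι y = 1 := by rw [← map_mul, hy, map_one]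
    let φ : SympFiber (p + 1) M →+* SympFiber p M' :=
      lift M (ι.comp ((algebraMap P D').comp C))
        (Fin.cons (fun k => ι (a k)) fun j =>
          sympExtend (fun k => ι (a k)) (ι y) (ι (s j)) (coord M' j) (ι (c j))) (by
        intro i j hij
        obtain ⟨j, rfl⟩ := Fin.exists_succ_eq.2 (Fin.ne_zero_of_lt hij)
        induction i using Fin.cases with
        | zero =>
          simp only [Fin.cons_zero, Fin.cons_succ]
          exact sympForm_sympExtend_right hιy _ _ _
        | succ i =>
          simp only [Fin.cons_succ]
          rw [sympForm_sympExtend hιy, sympForm_coord M' (Fin.succ_lt_succ_iff.1 hij)]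
          simp only [M', map_sub, map_add, map_mul, RingHom.comp_apply]
          ring)
    let z := coord (p := p + 1) M 0 (Sum.inr 0)
    let L := Localization.Away z
    let κ := algebraMap (SympFiber (p + 1) M) L
    have hκ : Function.Injective κ := IsLocalization.injective L
      (Submonoid.powers_le.2 (coord_zero_mem_nonZeroDivisors h M))
    let A (i k) : L := κ (coord M i k)
    let t : L := IsLocalization.Away.invSelf z
    have ht : A 0 (Sum.inr 0) * t = 1 := IsLocalization.Away.mul_invSelf z
    let θ₀ : P →+* L := eval₂Hom (κ.comp (algebraMap D _))
      (Sum.elim (A 0) fun j => A j.succ (Sum.inr 0) * t)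
    have hx : IsUnit (θ₀ x) := by
      rw [show θ₀ x = A 0 (Sum.inr 0) from eval₂Hom_X' _ _ _]
      exact IsUnit.of_mul_eq_one _ ht
    let θ : D' →+* L := IsLocalization.Away.lift x hx
    have hθ (f : P) : θ (algebraMap P D' f) = θ₀ f := IsLocalization.Away.lift_eq x hx f
    have hθa (k) : θ (a k) = A 0 k := (hθ _).trans (eval₂Hom_X' _ _ _)
    have hθs (j) : θ (s j) = A j.succ (Sum.inr 0) * t := (hθ _).trans (eval₂Hom_X' _ _ _)
    have hθC (d : D) : θ (algebraMap P D' (C d)) = κ (algebraMap D _ d) := 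
      (hθ _).trans (eval₂Hom_C _ _ _)
    have hθy : θ y = t := by
      have : A 0 (Sum.inr 0) * θ y = 1 := by rw [← hθa, ← map_mul, hy, map_one]
      linear_combination t * this - θ y * ht
    have hA (i j) (hij : i < j) : sympForm (A i) (A j) = κ (algebraMap D _ (M i j)) := by
      rw [← sympForm_coord M hij, map_sympForm]
    let W (j : Fin n) (k) : L :=
      sympTail (A j.succ) k + -(A j.succ (Sum.inr 0) * t) * sympTail (A 0) k
    have hW (j : Fin n) : sympExtend (A 0) t (A j.succ (Sum.inr 0) * t) (W j)
        (κ (algebraMap D _ (M 0 j.succ))) = A j.succ := by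
      rw [← hA 0 j.succ j.succ_pos]
      exact sympExtend_self ht _
    let ψ : SympFiber p M' →+* L := lift M' θ W (by
      intro i j hij
      have := sympForm_sympExtend ht (A i.succ (Sum.inr 0) * t) (A j.succ (Sum.inr 0) * t)
        (W i) (W j) (κ (algebraMap D _ (M 0 i.succ))) (κ (algebraMap D _ (M 0 j.succ)))
      rw [hW, hW, hA _ _ (Fin.succ_lt_succ_iff.2 hij)] at this
      simp only [M', c, map_sub, map_add, map_mul, hθC, hθs]
      linear_combination -this)
    have hψι (d) : ψ (ι d) = θ d := lift_algebraMap _ d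
    have hψφ : ψ.comp φ = κ := by
      refine ringHom_ext (fun d => ?_) fun i k => ?_
      · simp only [RingHom.comp_apply, φ, lift_algebraMap, hψι, hθC]
      · simp only [RingHom.comp_apply, φ, lift_coord]
        induction i using Fin.cases with
        | zero => simp only [Fin.cons_zero, hψι, hθa, A]
        | succ j =>
          simp only [Fin.cons_succ, map_sympExtend, hψι, hθa, hθy, hθs, c, hθC, ψ, lift_coord]
          exact congrFun (hW j) k
    have hφ : Function.Injective φ := by
      refine Function.Injective.of_comp (f := ψ) ?_
      rw [← RingHom.coe_comp, hψφ]
      exact hκ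
    exact hφ.isDomain φ

end SympFiber

end SymplecticFiber

lemma finLow_finHigh_bijective (p : ℕ) :
    Function.Bijective (Sum.elim (finLow p) (finHigh p)) := by
  constructor
  · rintro (⟨k, hk⟩ | ⟨k, hk⟩) (⟨l, hl⟩ | ⟨l, hl⟩) h <;>
      simp only [Sum.elim_inl, Sum.elim_inr, finLow, finHigh, Fin.mk.injEq, Sum.inl.injEq,
        Sum.inr.injEq, reduceCtorEq] at h ⊢ <;> omega
  · intro k
    by_cases hk : (k : ℕ) < p
    · exact ⟨Sum.inl ⟨k, hk⟩, rfl⟩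
    · exact ⟨Sum.inr ⟨k - p, by omega⟩, Fin.ext (Nat.sub_add_cancel (not_lt.1 hk))⟩

/-- The two halves of the row indices. -/
noncomputable def finLowHighEquiv (p : ℕ) : Fin p ⊕ Fin p ≃ Fin (2 * p) :=
  Equiv.ofBijective _ (finLow_finHigh_bijective p)

lemma finLowHighEquiv_symm_finLow (p : ℕ) (k : Fin p) :
    (finLowHighEquiv p).symm (finLow p k) = Sum.inl k :=
  (finLowHighEquiv p).symm_apply_apply (Sum.inl k)

lemma finLowHighEquiv_symm_finHigh (p : ℕ) (k : Fin p) :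
    (finLowHighEquiv p).symm (finHigh p k) = Sum.inr k :=
  (finLowHighEquiv p).symm_apply_apply (Sum.inr k)

/-- For the dual pair `(Sp(p,q), O*(2n))` in the stable range `n ≤ min(p,q)`,
the scheme-theoretic fiber of the moment map `ψ(A,B) = (AᵀJ_pA, BᵀJ_qB)` over any
point `(X,Y)` (with `X`, `Y` alternating) is reduced and irreducible: the quotient
of the polynomial ring by the fiber ideal is an integral domain. -/
theorem momentFiberSpOst_isDomain (p q n : ℕ) (hp : 0 < p) (hq : 0 < q) (hn : 0 < n)
    (h1 : n ≤ p) (h2 : n ≤ q) (Xm Ym : Matrix (Fin n) (Fin n) ℂ)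
    (hX : Xmᵀ = -Xm) (hX0 : ∀ i, Xm i i = 0)
    (hY : Ymᵀ = -Ym) (hY0 : ∀ i, Ym i i = 0) :
    IsDomain (MvPolynomial ((Fin (2 * p) × Fin n) ⊕ (Fin (2 * q) × Fin n)) ℂ ⧸
      momentFiberIdealSpOst p q n Xm Ym) := by
  let M₁ (i j : Fin n) : ℂ := Xm i j
  let M₂ (i j : Fin n) : SympFiber p M₁ := algebraMap ℂ (SympFiber p M₁) (Ym i j)
  have hD : IsDomain (SympFiber p M₁) := SympFiber.isDomain h1 _
  have hE : IsDomain (SympFiber q M₂) := SympFiber.isDomain h2 M₂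
  let ι := algebraMap (SympFiber p M₁) (SympFiber q M₂)
  let I := momentFiberIdealSpOst p q n Xm Ym
  let π := Ideal.Quotient.mk I
  let φ₀ : MvPolynomial ((Fin (2 * p) × Fin n) ⊕ (Fin (2 * q) × Fin n)) ℂ →+* SympFiber q M₂ :=
    eval₂Hom (ι.comp (algebraMap ℂ _))
      (Sum.elim (fun ki => ι (SympFiber.coord M₁ ki.2 ((finLowHighEquiv p).symm ki.1)))
        fun lj => SympFiber.coord M₂ lj.2 ((finLowHighEquiv q).symm lj.1))
  have hφC (d : ℂ) : φ₀ (C d) = ι (algebraMap ℂ _ d) := eval₂Hom_C _ _ _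
  have hφl (k i) : φ₀ (X (Sum.inl (k, i))) =
      ι (SympFiber.coord M₁ i ((finLowHighEquiv p).symm k)) := eval₂Hom_X' _ _ _
  have hφr (l j) : φ₀ (X (Sum.inr (l, j))) =
      SympFiber.coord M₂ j ((finLowHighEquiv q).symm l) := eval₂Hom_X' _ _ _
  have hI : I ≤ RingHom.ker φ₀ := by
    refine Ideal.span_le.2 ?_
    rintro _ (⟨i, j, hij, rfl⟩ | ⟨i, j, hij, rfl⟩)
    · have := congrArg ι (SympFiber.sympForm_coord (p := p) M₁ hij)
      rw [SetLike.mem_coe, RingHom.mem_ker, map_sub, hφC, sub_eq_zero, ← this]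
      simp only [sympForm, map_sum, map_sub, map_mul, hφl, finLowHighEquiv_symm_finLow,
        finLowHighEquiv_symm_finHigh]
    · have := SympFiber.sympForm_coord (p := q) M₂ hij
      rw [SetLike.mem_coe, RingHom.mem_ker, map_sub, hφC, sub_eq_zero, ← this]
      simp only [sympForm, map_sum, map_sub, map_mul, hφr, finLowHighEquiv_symm_finLow,
        finLowHighEquiv_symm_finHigh]
  let φ := Ideal.Quotient.lift I φ₀ hI
  let θ : SympFiber p M₁ →+* _ ⧸ I := SympFiber.lift M₁ (π.comp C)
    (fun i k => π (X (Sum.inl (finLowHighEquiv p k, i)))) (by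
      intro i j hij
      rw [← map_sympForm, ← sub_eq_zero, RingHom.comp_apply, ← map_sub]
      exact Ideal.Quotient.eq_zero_iff_mem.2 (Ideal.subset_span (Or.inl ⟨i, j, hij, rfl⟩)))
  have hθC (d) : θ (algebraMap ℂ _ d) = π (C d) := SympFiber.lift_algebraMap _ d
  have hθX (i k) : θ (SympFiber.coord M₁ i k) = π (X (Sum.inl (finLowHighEquiv p k, i))) :=
    SympFiber.lift_coord _ i k
  let ψ : SympFiber q M₂ →+* _ ⧸ I := SympFiber.lift M₂ θ
    (fun j l => π (X (Sum.inr (finLowHighEquiv q l, j)))) (by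
      intro i j hij
      rw [← map_sympForm, hθC, ← sub_eq_zero, ← map_sub]
      exact Ideal.Quotient.eq_zero_iff_mem.2 (Ideal.subset_span (Or.inr ⟨i, j, hij, rfl⟩)))
  have hψι (d) : ψ (ι d) = θ d := SympFiber.lift_algebraMap _ d
  have hψφ : ψ.comp φ₀ = π := by
    refine MvPolynomial.ringHom_ext (fun d => ?_) ?_
    · rw [RingHom.comp_apply, hφC, hψι, hθC]
    · rintro (⟨k, i⟩ | ⟨l, j⟩)
      · rw [RingHom.comp_apply, hφl, hψι, hθX, Equiv.apply_symm_apply]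
      · rw [RingHom.comp_apply, hφr, SympFiber.lift_coord, Equiv.apply_symm_apply]
  have hφ : Function.Injective φ := by
    refine Function.LeftInverse.injective (g := ψ) fun z => ?_
    obtain ⟨f, rfl⟩ := Ideal.Quotient.mk_surjective z
    exact RingHom.congr_fun hψφ f
  exact hφ.isDomain φ
end
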